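/- Local intersections of injective pseudoholomorphic curves: Let J be an almost complex structure on ℂⁿ and let u, v : B → ℂⁿ be injective smooth J-holomorphic curves with u(0) = v(0) = 0. Then for all sufficiently small ε > 0, either there exists a holomorphic map φ : B_ε → B with φ(0) = 0 such that u = v ∘ φ on B_ε, or the images u(B_ε \ {0}) and v(B_ε \ {0}) are disjoint. -/

import Mathlib

open Metric Complex

section LocalIntersections

open MeasureTheory Filter Topology Set

/-- Twice the Cauchy-Riemann operator `∂/∂z̄`. -/
noncomputable def dbar {E : Type*} [NormedAddCommGroup E] [NormedSpace ℂ E]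
    (f : ℂ → E) (z : ℂ) : E :=
  fderiv ℝ f z 1 + I • fderiv ℝ f z I

section CauchyRiemannOperator

variable {E : Type*} [NormedAddCommGroup E] [NormedSpace ℂ E]

theorem dbar_smul {f : ℂ → ℂ} {g : ℂ → E} {z : ℂ} (hf : DifferentiableAt ℝ f z)
    (hg : DifferentiableAt ℝ g z) :
    dbar (fun w => f w • g w) z = f z • dbar g z + dbar f z • g z := by
  simp only [dbar]
  rw [fderiv_fun_smul hf hg]
  simp only [add_apply, smul_apply,
    ContinuousLinearMap.smulRight_apply, smul_add, add_smul, smul_eq_mul, mul_smul]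
  rw [smul_comm I (f z)]
  abel

theorem dbar_eq_zero_of_differentiableAt {f : ℂ → E} {z : ℂ} (hf : DifferentiableAt ℂ f z) :
    dbar f z = 0 := by
  have h := hf.hasFDerivAt.restrictScalars ℝ
  have h1 : fderiv ℂ f z I = I • fderiv ℂ f z 1 := by
    rw [← map_smul]; simp
  simp only [dbar, h.fderiv, ContinuousLinearMap.coe_restrictScalars']
  rw [h1, smul_smul, I_mul_I]
  simp

theorem dbar_of_eventuallyEq_zero {f : ℂ → E} {z : ℂ} (hf : f =ᶠ[𝓝 z] 0) : dbar f z = 0 := by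
  have : fderiv ℝ f z = 0 := by
    rw [hf.fderiv_eq]; simp
  simp [dbar, this]

theorem aestronglyMeasurable_dbar [FiniteDimensional ℂ E] (f : ℂ → E) :
    AEStronglyMeasurable (dbar f) volume := by
  borelize E
  have : ProperSpace E := FiniteDimensional.proper ℂ E
  exact ((measurable_fderiv_apply_const ℝ f 1).add
    ((measurable_fderiv_apply_const ℝ f I).const_smul I)).aestronglyMeasurable

theorem integral_dbar_eq_zero [CompleteSpace E] {f : ℂ → E} {R : ℝ} (hR : 0 < R)
    (hc : Continuous f)
    (hz : ∀ z, R ≤ ‖z‖ → f z = 0) (hd : ∀ z, z ≠ 0 → DifferentiableAt ℝ f z)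
    (hi : Integrable (dbar f)) : ∫ z, dbar f z = 0 := by
  have hdz : ∀ z, R < ‖z‖ → dbar f z = 0 := fun z hzR => by
    apply dbar_of_eventuallyEq_zero
    filter_upwards [(continuous_norm.isOpen_preimage _ isOpen_Ioi).mem_nhds hzR] with w hw
    exact hz w (le_of_lt hw)
  have key := integral_boundary_rect_of_hasFDerivAt_real_off_countable f (fderiv ℝ f)
    (-R - R * I) (R + R * I) {0} (countable_singleton 0) hc.continuousOn
    (fun x hx => (hd x hx.2).hasFDerivAt) ?_
  · have e1 : ∀ z : ℂ, I • fderiv ℝ f z 1 - fderiv ℝ f z I = I • dbar f z := fun z => by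
      simp only [dbar, smul_add, smul_smul, I_mul_I, neg_smul, one_smul, sub_eq_add_neg]
    simp only [e1] at key
    simp at key
    have b1 : ∀ x : ℝ, f (x + -(R * I)) = 0 := fun x => hz _ <| by
      have := abs_im_le_norm (x + -(R * I)); simp at this
      rwa [abs_of_pos hR] at this
    have b2 : ∀ x : ℝ, f (x + R * I) = 0 := fun x => hz _ <| by
      have := abs_im_le_norm (x + (R * I)); simp at this
      rwa [abs_of_pos hR] at this
    have b3 : ∀ x : ℝ, f (R + x * I) = 0 := fun x => hz _ <| by
      have := abs_re_le_norm (R + (x * I)); simp at this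
      rwa [abs_of_pos hR] at this
    have b4 : ∀ x : ℝ, f (-R + x * I) = 0 := fun x => hz _ <| by
      have := abs_re_le_norm (-R + (x * I)); simp at this
      rwa [abs_of_pos hR] at this
    simp [b1, b2, b3, b4] at key
    have habs : ∀ y : ℝ, y ∉ Ioc (-R) R → y ≠ -R → R < |y| := fun y hy h => by
      rw [mem_Ioc, not_and_or] at hy
      rw [lt_abs]
      rcases hy with hy | hy
      · right
        have := lt_of_le_of_ne (not_lt.1 hy) h
        linarith
      · left; linarith
    have e2 : ∀ x y : ℝ, y ∉ Ioc (-R) R → y ≠ -R → dbar f (x + y * I) = 0 := fun x y hy h =>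
      hdz _ <| lt_of_lt_of_le (by simpa using habs y hy h) (abs_im_le_norm _)
    have e3 : ∀ x y : ℝ, x ∉ Ioc (-R) R → x ≠ -R → dbar f (x + y * I) = 0 := fun x y hx h =>
      hdz _ <| lt_of_lt_of_le (by simpa using habs x hx h) (abs_re_le_norm _)
    have hRR : -R ≤ R := by linarith
    have i1 : ∀ x : ℝ, ∫ y in -R..R, dbar f (x + y * I) = ∫ y : ℝ, dbar f (x + y * I) :=
      fun x => by
      rw [intervalIntegral.integral_of_le hRR, ← integral_indicator measurableSet_Ioc]
      apply integral_congr_ae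
      filter_upwards [compl_mem_ae_iff.2 (measure_singleton (-R))] with y hy
      by_cases h : y ∈ Ioc (-R) R
      · rw [indicator_of_mem h]
      · rw [indicator_of_notMem h]
        exact (e2 x y h hy).symm
    simp only [i1] at key
    have i2 : ∫ x in -R..R, ∫ y : ℝ, dbar f (x + y * I) = ∫ x : ℝ, ∫ y : ℝ, dbar f (x + y * I) := by
      rw [intervalIntegral.integral_of_le hRR, ← integral_indicator measurableSet_Ioc]
      apply integral_congr_ae
      filter_upwards [compl_mem_ae_iff.2 (measure_singleton (-R))] with x hx
      by_cases h : x ∈ Ioc (-R) R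
      · rw [indicator_of_mem h]
      · rw [indicator_of_notMem h]
        have : ∀ y : ℝ, dbar f (x + y * I) = 0 := fun y => e3 x y h hx
        simp [this]
    rw [i2] at key
    rw [← (smul_eq_zero.1 key.symm).resolve_left I_ne_zero]
    have hp := Complex.volume_preserving_equiv_real_prod.symm
    rw [← hp.integral_comp measurableEquivRealProd.symm.measurableEmbedding,
      Measure.volume_eq_prod, integral_prod]
    · simp [measurableEquivRealProd_symm_apply, mk_eq_add_mul_I]
    · rw [← Measure.volume_eq_prod]
      exact hp.integrable_comp_of_integrable hi
  · have e1 : ∀ z : ℂ, I • fderiv ℝ f z 1 - fderiv ℝ f z I = I • dbar f z := fun z => by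
      simp only [dbar, smul_add, smul_smul, I_mul_I, neg_smul, one_smul, sub_eq_add_neg]
    simp only [e1]
    exact (hi.smul I).integrableOn

end CauchyRiemannOperator

section CauchyPompeiu

variable {E : Type*} [NormedAddCommGroup E] [NormedSpace ℂ E]

/-- A bounded approximation of the Cauchy kernel `1/z`. -/
noncomputable def cauchyKernelApprox (ε : ℝ) (w : ℂ) : ℂ :=
  (starRingEnd ℂ) w * (w * (starRingEnd ℂ) w + (ε : ℂ) ^ 2)⁻¹

theorem mul_conj_add_sq (ε : ℝ) (w : ℂ) :
    w * (starRingEnd ℂ) w + (ε : ℂ) ^ 2 = ((‖w‖ ^ 2 + ε ^ 2 : ℝ) : ℂ) := by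
  rw [mul_conj, normSq_eq_norm_sq]; push_cast; ring

theorem mul_conj_add_sq_ne_zero {ε : ℝ} (hε : ε ≠ 0) (w : ℂ) :
    w * (starRingEnd ℂ) w + (ε : ℂ) ^ 2 ≠ 0 := by
  rw [mul_conj_add_sq]
  exact_mod_cast (by positivity : (0 : ℝ) < ‖w‖ ^ 2 + ε ^ 2).ne'

theorem differentiable_cauchyKernelApprox {ε : ℝ} (hε : ε ≠ 0) :
    Differentiable ℝ (cauchyKernelApprox ε) := by
  have hc : Differentiable ℝ (starRingEnd ℂ : ℂ → ℂ) := conjCLE.differentiable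
  unfold cauchyKernelApprox
  exact hc.mul (((differentiable_id.mul hc).add_const _).inv (mul_conj_add_sq_ne_zero hε))

theorem dbar_conj (z : ℂ) : dbar (starRingEnd ℂ : ℂ → ℂ) z = 2 := by
  have : fderiv ℝ (starRingEnd ℂ : ℂ → ℂ) z = conjCLE := conjCLE.fderiv
  simp [dbar, this]
  norm_num

theorem dbar_cauchyKernelApprox {ε : ℝ} (hε : ε ≠ 0) (w : ℂ) :
    dbar (cauchyKernelApprox ε) w = ((2 * ε ^ 2 / (‖w‖ ^ 2 + ε ^ 2) ^ 2 : ℝ) : ℂ) := by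
  have hc : Differentiable ℝ (starRingEnd ℂ : ℂ → ℂ) := conjCLE.differentiable
  have hD : ∀ w : ℂ, dbar (fun w : ℂ => w * (starRingEnd ℂ) w + (ε : ℂ) ^ 2) w = 2 * w := by
    intro w
    have h1 := dbar_smul (f := fun w : ℂ => w) (g := starRingEnd ℂ) (z := w)
      differentiableAt_id (hc w)
    rw [dbar_conj, dbar_eq_zero_of_differentiableAt (f := fun w : ℂ => w) differentiableAt_id] at h1
    have h2 : dbar (fun w : ℂ => w * (starRingEnd ℂ) w + (ε : ℂ) ^ 2) w =
        dbar (fun w : ℂ => w • (starRingEnd ℂ) w) w := by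
      simp only [dbar, smul_eq_mul, fderiv_add_const]
    rw [h2, h1]; simp [mul_comm]
  have hne := mul_conj_add_sq_ne_zero hε w
  have h3 := dbar_smul (z := w) (differentiable_cauchyKernelApprox hε w)
    (g := fun w : ℂ => w * (starRingEnd ℂ) w + (ε : ℂ) ^ 2)
    ((differentiable_id.mul hc).add_const _ w)
  have h4 : (fun w : ℂ => cauchyKernelApprox ε w • (w * (starRingEnd ℂ) w + (ε : ℂ) ^ 2)) =
      starRingEnd ℂ := by
    ext w
    have hne := mul_conj_add_sq_ne_zero hε w
    simp only [cauchyKernelApprox, smul_eq_mul]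
    rw [mul_assoc, inv_mul_cancel₀ hne, mul_one]
  rw [h4, dbar_conj, hD, smul_eq_mul, smul_eq_mul] at h3
  have h5 : dbar (cauchyKernelApprox ε) w =
      2 * (ε : ℂ) ^ 2 / (w * (starRingEnd ℂ) w + (ε : ℂ) ^ 2) ^ 2 := by
    have h6 : cauchyKernelApprox ε w * (w * (starRingEnd ℂ) w + (ε : ℂ) ^ 2) =
      (starRingEnd ℂ) w := congrFun h4 w
    rw [eq_div_iff (pow_ne_zero _ hne)]
    linear_combination (-(w * (starRingEnd ℂ) w + (ε : ℂ) ^ 2)) * h3 - (2 * w) * h6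
  rw [h5, mul_conj_add_sq]
  push_cast; ring

theorem norm_cauchyKernelApprox_le (ε : ℝ) (w : ℂ) : ‖cauchyKernelApprox ε w‖ ≤ ‖w‖⁻¹ := by
  rw [cauchyKernelApprox, mul_conj_add_sq, norm_mul, norm_inv, norm_real, RCLike.norm_conj,
    Real.norm_of_nonneg (by positivity)]
  by_cases hw : w = 0
  · simp [hw]
  have : 0 < ‖w‖ := norm_pos_iff.2 hw
  rw [← div_eq_mul_inv, div_le_iff₀ (by positivity), inv_mul_eq_div, le_div_iff₀ this]
  nlinarith [sq_nonneg ε]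

theorem tendsto_cauchyKernelApprox (w : ℂ) :
    Tendsto (fun ε => cauchyKernelApprox ε w) (𝓝 0) (𝓝 w⁻¹) := by
  by_cases hw : w = 0
  · simp [hw, cauchyKernelApprox]
  have : w⁻¹ = cauchyKernelApprox 0 w := by
    have : (starRingEnd ℂ) w ≠ 0 := by simpa using hw
    simp [cauchyKernelApprox]
    field_simp
  rw [this]
  apply ContinuousAt.tendsto
  unfold cauchyKernelApprox
  refine continuousAt_const.mul (ContinuousAt.inv₀ (by fun_prop) ?_)
  simpa using hw

/-- The normalisation constant in the Cauchy-Pompeiu formula. -/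
noncomputable def pompeiuConst : ℝ := ∫ w : ℂ, 2 / (1 + ‖w‖ ^ 2) ^ 2

theorem integrable_pompeiuConst : Integrable (fun w : ℂ => 2 / (1 + ‖w‖ ^ 2) ^ 2) := by
  have h := integrable_rpow_neg_one_add_norm_sq (E := ℂ) (μ := volume) (r := 4) (by simp; norm_num)
  have h2 := h.const_mul 2
  refine h2.congr (Eventually.of_forall fun w => ?_)
  simp only
  rw [show (-4 / 2 : ℝ) = -((2 : ℕ) : ℝ) by norm_num, Real.rpow_neg (by positivity),
    Real.rpow_natCast]
  rfl

theorem pompeiuConst_pos : 0 < pompeiuConst := by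
  unfold pompeiuConst
  rw [integral_pos_iff_support_of_nonneg (fun w => by positivity) integrable_pompeiuConst]
  have : Function.support (fun w : ℂ => 2 / (1 + ‖w‖ ^ 2) ^ 2) = univ := by
    ext w; simp; positivity
  rw [this]
  simp

end CauchyPompeiu

section CauchyTransform

variable {E : Type*} [NormedAddCommGroup E] [NormedSpace ℂ E]

/-- The kernel `|w| ^ (-3 / 2)` cut off to the disc of radius `2 * R`. -/
noncomputable def cutKernel (R : ℝ) : ℂ → ℝ :=
  (ball (0 : ℂ) (2 * R)).indicator fun w => (√‖w‖)⁻¹ ^ 3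

theorem cutKernel_of_lt {R : ℝ} {w : ℂ} (hw : ‖w‖ < 2 * R) : cutKernel R w = (√‖w‖)⁻¹ ^ 3 :=
  indicator_of_mem (by simpa using hw) _

theorem cutKernel_nonneg (R : ℝ) (w : ℂ) : 0 ≤ cutKernel R w :=
  indicator_nonneg (fun w _ => by positivity) _

theorem cutKernel_mono {R S : ℝ} (h : R ≤ S) (w : ℂ) : cutKernel R w ≤ cutKernel S w :=
  indicator_le_indicator_of_subset (ball_subset_ball (by linarith)) (fun w => by positivity) _

theorem integrable_cutKernel (R : ℝ) : Integrable (cutKernel R) := by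
  unfold cutKernel
  rw [integrable_indicator_iff measurableSet_ball]
  refine integrableOn_ball_of_norm_le_rpow (α := 3 / 2) (C := 1) (by simp) (by simp; norm_num)
    (Eventually.of_forall fun w => ?_) (by fun_prop)
  rw [Real.norm_of_nonneg (by positivity), one_mul, Real.rpow_neg (by positivity),
    show (3 / 2 : ℝ) = (1 / 2) * (3 : ℕ) by norm_num, Real.rpow_mul (by positivity),
    ← Real.sqrt_eq_rpow, Real.rpow_natCast, inv_pow]

theorem integral_cutKernel_sub (R : ℝ) (z : ℂ) :
    ∫ w, cutKernel R (w - z) = ∫ w, cutKernel R w :=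
  integral_sub_right_eq_self _ z

theorem inv_mul_inv_sq_le {a b : ℝ} (ha : 0 ≤ a) (hb : 0 ≤ b) :
    a⁻¹ * b⁻¹ ^ 2 ≤ a⁻¹ ^ 3 + b⁻¹ ^ 3 := by
  have hA : 0 ≤ a⁻¹ := inv_nonneg.2 ha
  have hB : 0 ≤ b⁻¹ := inv_nonneg.2 hb
  set A := a⁻¹
  set B := b⁻¹
  rcases le_total A B with h | h
  · nlinarith [pow_nonneg hA 3, pow_nonneg hB 2, mul_le_mul_of_nonneg_right h (pow_nonneg hB 2)]
  · have : B ^ 2 ≤ A ^ 2 := by gcongr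
    nlinarith [pow_nonneg hB 3, mul_le_mul_of_nonneg_left this hA]

theorem inv_sq_sqrt (w : ℂ) : (√‖w‖)⁻¹ ^ 2 = ‖w‖⁻¹ := by
  rw [inv_pow, Real.sq_sqrt (norm_nonneg _)]

theorem norm_sub_lt_two_mul {R : ℝ} {ζ z : ℂ} (hζ : ‖ζ‖ < R) (hz : ‖z‖ < R) :
    ‖ζ - z‖ < 2 * R := by
  linarith [norm_sub_le ζ z]

theorem norm_cauchy_smul_le {R C : ℝ} {D : ℂ → E}
    (hs : ∀ ζ, R ≤ ‖ζ‖ → D ζ = 0) (hC : 0 ≤ C) {z ζ : ℂ}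
    (hb : ‖D ζ‖ ≤ C * (√‖ζ‖)⁻¹) (hz : ‖z‖ < R) :
    ‖(ζ - z)⁻¹ • D ζ‖ ≤ C * (cutKernel R ζ + cutKernel R (ζ - z)) := by
  by_cases hR : R ≤ ‖ζ‖
  · rw [hs ζ hR]; simp
    exact mul_nonneg hC (add_nonneg (cutKernel_nonneg _ _) (cutKernel_nonneg _ _))
  push Not at hR
  have h2 : ‖ζ‖ < 2 * R := by linarith [norm_nonneg ζ]
  rw [cutKernel_of_lt h2, cutKernel_of_lt (norm_sub_lt_two_mul hR hz), norm_smul, norm_inv,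
    ← inv_sq_sqrt]
  calc (√‖ζ - z‖)⁻¹ ^ 2 * ‖D ζ‖ ≤ (√‖ζ - z‖)⁻¹ ^ 2 * (C * (√‖ζ‖)⁻¹) := by gcongr
    _ = C * ((√‖ζ‖)⁻¹ * (√‖ζ - z‖)⁻¹ ^ 2) := by ring
    _ ≤ _ := by
      gcongr
      exact inv_mul_inv_sq_le (Real.sqrt_nonneg _) (Real.sqrt_nonneg _)

theorem integrable_cauchy_smul {R C : ℝ} {D : ℂ → E} (hD : AEStronglyMeasurable D)
    (hs : ∀ ζ, R ≤ ‖ζ‖ → D ζ = 0) (hC : 0 ≤ C)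
    (hb : ∀ ζ, ζ ≠ 0 → ‖D ζ‖ ≤ C * (√‖ζ‖)⁻¹) {z : ℂ} (hz : ‖z‖ < R) :
    Integrable fun ζ => (ζ - z)⁻¹ • D ζ := by
  refine (((integrable_cutKernel R).add ((integrable_cutKernel R).comp_sub_right z)).const_mul
    C).mono' ?_ ?_
  · exact (by fun_prop : Measurable fun ζ : ℂ => (ζ - z)⁻¹).aestronglyMeasurable.smul hD
  · filter_upwards [compl_mem_ae_iff.2 (measure_singleton (0 : ℂ))] with ζ hζ
    exact norm_cauchy_smul_le hs hC (hb ζ hζ) hz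

theorem norm_integral_cauchy_smul_le {R C : ℝ} {D : ℂ → E}
    (hs : ∀ ζ, R ≤ ‖ζ‖ → D ζ = 0) (hC : 0 ≤ C)
    (hb : ∀ ζ, ζ ≠ 0 → ‖D ζ‖ ≤ C * (√‖ζ‖)⁻¹) {z : ℂ} (hz : ‖z‖ < R) :
    ‖∫ ζ, (ζ - z)⁻¹ • D ζ‖ ≤ 2 * C * ∫ w, cutKernel R w := by
  have h := norm_integral_le_of_norm_le (f := fun ζ => (ζ - z)⁻¹ • D ζ)
    (((integrable_cutKernel R).add ((integrable_cutKernel R).comp_sub_right z)).const_mul C) (by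
      filter_upwards [compl_mem_ae_iff.2 (measure_singleton (0 : ℂ))] with ζ hζ
      exact norm_cauchy_smul_le hs hC (hb ζ hζ) hz)
  refine h.trans (le_of_eq ?_)
  simp only [Pi.add_apply]
  rw [integral_const_mul, integral_add (integrable_cutKernel R)
    ((integrable_cutKernel R).comp_sub_right z), integral_cutKernel_sub]
  ring

theorem norm_integral_cauchy_smul_le_of_bounded {R C : ℝ} {D : ℂ → E}
    (hs : ∀ ζ, R ≤ ‖ζ‖ → D ζ = 0) (hC : 0 ≤ C)
    (hb : ∀ ζ, ζ ≠ 0 → ‖D ζ‖ ≤ C) {z : ℂ} (hz : ‖z‖ < R) :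
    ‖∫ ζ, (ζ - z)⁻¹ • D ζ‖ ≤ C * √(2 * R) * ∫ w, cutKernel R w := by
  have hpos : ∀ ζ, 0 ≤ C * √(2 * R) * cutKernel R (ζ - z) := fun ζ => 
    mul_nonneg (by positivity) (cutKernel_nonneg _ _)
  have h := norm_integral_le_of_norm_le (f := fun ζ => (ζ - z)⁻¹ • D ζ)
    (((integrable_cutKernel R).comp_sub_right z).const_mul (C * √(2 * R))) (by
      filter_upwards [compl_mem_ae_iff.2 (measure_singleton (0 : ℂ))] with ζ hζ
      by_cases hR : R ≤ ‖ζ‖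
      · rw [hs ζ hR]; simpa using hpos ζ
      push Not at hR
      have hlt := norm_sub_lt_two_mul hR hz
      rw [cutKernel_of_lt hlt, norm_smul, norm_inv, ← inv_sq_sqrt]
      calc (√‖ζ - z‖)⁻¹ ^ 2 * ‖D ζ‖ ≤ (√‖ζ - z‖)⁻¹ ^ 2 * C * 1 := by
            rw [mul_one]; gcongr; exact hb ζ hζ
        _ ≤ C * √(2 * R) * (√‖ζ - z‖)⁻¹ ^ 3 := by
          by_cases h0 : √‖ζ - z‖ = 0
          · simp [h0]
          have : 0 < √‖ζ - z‖ := lt_of_le_of_ne (Real.sqrt_nonneg _) (Ne.symm h0)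
          rw [show C * √(2 * R) * (√‖ζ - z‖)⁻¹ ^ 3 =
            (√‖ζ - z‖)⁻¹ ^ 2 * C * (√(2 * R) / √‖ζ - z‖) by ring]
          gcongr
          rw [one_le_div this]
          exact Real.sqrt_le_sqrt hlt.le)
  refine h.trans (le_of_eq ?_)
  rw [integral_const_mul, integral_cutKernel_sub]

theorem norm_integral_cauchy_smul_sub_le {R C : ℝ} {D : ℂ → E} (hD : AEStronglyMeasurable D)
    (hs : ∀ ζ, R ≤ ‖ζ‖ → D ζ = 0) (hC : 0 ≤ C)
    (hb : ∀ ζ, ζ ≠ 0 → ‖D ζ‖ ≤ C) {z : ℂ} (hz : ‖z‖ < R) :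
    ‖(∫ ζ, (ζ - z)⁻¹ • D ζ) - ∫ ζ, ζ⁻¹ • D ζ‖ ≤
      4 * C * (∫ w, cutKernel R w) * √‖z‖ := by
  have hR0 : 0 < R := (norm_nonneg z).trans_lt hz
  have hb' : ∀ ζ, ζ ≠ 0 → ‖D ζ‖ ≤ C * √R * (√‖ζ‖)⁻¹ := fun ζ hζ => by
    by_cases hR : R ≤ ‖ζ‖
    · rw [hs ζ hR]; simp; positivity
    push Not at hR
    refine (hb ζ hζ).trans ?_
    rw [mul_assoc]
    refine le_mul_of_one_le_right hC ?_
    have : 0 < √‖ζ‖ := Real.sqrt_pos.2 (norm_pos_iff.2 hζ)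
    rw [← div_eq_mul_inv, one_le_div this]
    exact Real.sqrt_le_sqrt hR.le
  have i1 := integrable_cauchy_smul hD hs (by positivity) hb' hz
  have i2 := integrable_cauchy_smul hD hs (by positivity) hb' (z := 0) (by simpa using hR0)
  simp only [sub_zero] at i2
  rw [← integral_sub i1 i2]
  have hpos : ∀ ζ, 0 ≤ 2 * C * √‖z‖ * (cutKernel R ζ + cutKernel R (ζ - z)) := fun ζ =>
    mul_nonneg (by positivity) (add_nonneg (cutKernel_nonneg _ _) (cutKernel_nonneg _ _))
  have h := norm_integral_le_of_norm_le (f := fun ζ => (ζ - z)⁻¹ • D ζ - ζ⁻¹ • D ζ)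
    (((integrable_cutKernel R).add ((integrable_cutKernel R).comp_sub_right z)).const_mul
      (2 * C * √‖z‖)) (by
      filter_upwards [compl_mem_ae_iff.2 (measure_singleton (0 : ℂ)),
        compl_mem_ae_iff.2 (measure_singleton z)] with ζ hζ hζz
      by_cases hR : R ≤ ‖ζ‖
      · rw [hs ζ hR]; simpa using hpos ζ
      push Not at hR
      have hlt := norm_sub_lt_two_mul hR hz
      have h2 : ‖ζ‖ < 2 * R := by linarith [norm_nonneg ζ]
      have hζ0 : ζ ≠ 0 := hζ
      have hζz' : ζ - z ≠ 0 := sub_ne_zero.2 hζz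
      simp only [Pi.add_apply]
      rw [cutKernel_of_lt hlt, cutKernel_of_lt h2, ← sub_smul, norm_smul,
        inv_sub_inv hζz' hζ0, sub_sub_cancel, norm_div, norm_mul]
      have hzz : √‖z‖ ≤ √‖ζ‖ + √‖ζ - z‖ := by
        refine (Real.sqrt_le_sqrt (?_ : ‖z‖ ≤ ‖ζ‖ + ‖ζ - z‖)).trans ?_
        · calc ‖z‖ = ‖ζ - (ζ - z)‖ := by rw [sub_sub_cancel]
            _ ≤ _ := norm_sub_le _ _
        · rw [Real.sqrt_le_left (by positivity), add_sq, Real.sq_sqrt (norm_nonneg _),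
            Real.sq_sqrt (norm_nonneg _)]
          linarith [mul_nonneg (Real.sqrt_nonneg ‖ζ‖) (Real.sqrt_nonneg ‖ζ - z‖)]
      have hsz : ‖z‖ = √‖z‖ * √‖z‖ := (Real.mul_self_sqrt (norm_nonneg _)).symm
      have ha : 0 < √‖ζ‖ := Real.sqrt_pos.2 (norm_pos_iff.2 hζ0)
      have hb0 : 0 < √‖ζ - z‖ := Real.sqrt_pos.2 (norm_pos_iff.2 hζz')
      have e1 := inv_mul_inv_sq_le ha.le hb0.le
      have e2 := inv_mul_inv_sq_le hb0.le ha.le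
      have hDb := hb ζ hζ
      rw [div_eq_mul_inv, mul_inv, ← inv_sq_sqrt, ← inv_sq_sqrt ζ]
      set a := √‖ζ‖
      set b := √‖ζ - z‖
      set s := √‖z‖
      calc ‖z‖ * (b⁻¹ ^ 2 * a⁻¹ ^ 2) * ‖D ζ‖ ≤ (s * (a + b)) * (b⁻¹ ^ 2 * a⁻¹ ^ 2) * C := by
            rw [hsz]; gcongr
        _ = C * s * (a⁻¹ * b⁻¹ ^ 2 * (a * a⁻¹) + b⁻¹ * a⁻¹ ^ 2 * (b * b⁻¹)) := by ring
        _ = C * s * (a⁻¹ * b⁻¹ ^ 2 + b⁻¹ * a⁻¹ ^ 2) := by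
            rw [mul_inv_cancel₀ ha.ne', mul_inv_cancel₀ hb0.ne', mul_one, mul_one]
        _ ≤ C * s * (2 * (a⁻¹ ^ 3 + b⁻¹ ^ 3)) := by
            have : 0 ≤ s := Real.sqrt_nonneg _
            gcongr
            linarith
        _ = _ := by ring)
  refine h.trans (le_of_eq ?_)
  simp only [Pi.add_apply]
  rw [integral_const_mul, integral_add (integrable_cutKernel R)
    ((integrable_cutKernel R).comp_sub_right z), integral_cutKernel_sub]
  ring

end CauchyTransform

section PompeiuFormula

variable {E : Type*} [NormedAddCommGroup E] [NormedSpace ℂ E]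

theorem fderiv_eq_zero_of_support {f : ℂ → E} {R : ℝ} (hs : ∀ z, R ≤ ‖z‖ → f z = 0) {z : ℂ}
    (hz : R < ‖z‖) : fderiv ℝ f z = 0 := by
  have : f =ᶠ[𝓝 z] 0 := by
    filter_upwards [(continuous_norm.isOpen_preimage _ isOpen_Ioi).mem_nhds hz] with w hw
    exact hs w (le_of_lt hw)
  rw [this.fderiv_eq]; simp

theorem dbar_eq_zero_of_support {f : ℂ → E} {R : ℝ} (hs : ∀ z, R ≤ ‖z‖ → f z = 0) {z : ℂ}
    (hz : R < ‖z‖) : dbar f z = 0 := by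
  simp [dbar, fderiv_eq_zero_of_support hs hz]

/-- The Cauchy-Pompeiu formula for compactly supported continuous functions which are
differentiable off the origin. -/
theorem pompeiu_formula [FiniteDimensional ℂ E] {g : ℂ → E} {R C : ℝ}
    (hc : Continuous g) (hs : ∀ z, R ≤ ‖z‖ → g z = 0)
    (hd : ∀ z, z ≠ 0 → DifferentiableAt ℝ g z) (hC : 0 ≤ C)
    (hb : ∀ z, z ≠ 0 → ‖dbar g z‖ ≤ C) (z : ℂ) (hz : ‖z‖ < R) :
    pompeiuConst • g z = -∫ ζ, (ζ - z)⁻¹ • dbar g ζ := by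
  have : CompleteSpace E := FiniteDimensional.complete ℂ E
  have hR0 : 0 < R := (norm_nonneg z).trans_lt hz
  have hm := aestronglyMeasurable_dbar g
  obtain ⟨B, hB⟩ : ∃ B, ∀ w, ‖g w‖ ≤ B := by
    have hcs : HasCompactSupport g := HasCompactSupport.intro (isCompact_closedBall 0 R)
      fun w hw => hs w (by simpa using (not_le.1 (by simpa using hw)).le)
    exact hcs.exists_bound_of_continuous hc
  have hdz : ∀ ζ, R < ‖ζ‖ → dbar g ζ = 0 := fun ζ h => dbar_eq_zero_of_support hs h
  have hRsz : R < R + 1 := by linarith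
  have hb' : ∀ ζ, ζ ≠ 0 → ‖dbar g ζ‖ ≤ C * √R * (√‖ζ‖)⁻¹ := fun ζ hζ => by
    by_cases hR : R < ‖ζ‖
    · rw [hdz ζ hR]; simp; positivity
    push Not at hR
    refine (hb ζ hζ).trans ?_
    rw [mul_assoc]
    refine le_mul_of_one_le_right hC ?_
    have : 0 < √‖ζ‖ := Real.sqrt_pos.2 (norm_pos_iff.2 hζ)
    rw [← div_eq_mul_inv, one_le_div this]
    exact Real.sqrt_le_sqrt hR
  have hint : Integrable fun ζ => (ζ - z)⁻¹ • dbar g ζ :=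
    integrable_cauchy_smul hm (fun ζ h => hdz ζ (by linarith)) (by positivity) hb'
      (hz.trans hRsz)
  have key : ∀ ε : ℝ, 0 < ε → ∫ ζ, cauchyKernelApprox ε (ζ - z) • dbar g ζ =
      -∫ w : ℂ, (2 / (1 + ‖w‖ ^ 2) ^ 2 : ℝ) • g (z + ε • w) := by
    intro ε hε
    have hk := differentiable_cauchyKernelApprox hε.ne'
    have hk' : Differentiable ℝ fun ζ => cauchyKernelApprox ε (ζ - z) :=
      hk.comp (differentiable_id.sub_const z)
    have hdk : ∀ ζ, dbar (fun ζ => cauchyKernelApprox ε (ζ - z)) ζ =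
        ((2 * ε ^ 2 / (‖ζ - z‖ ^ 2 + ε ^ 2) ^ 2 : ℝ) : ℂ) := fun ζ => by
      rw [← dbar_cauchyKernelApprox hε.ne']
      simp only [dbar, fderiv_comp_sub]
    have hi1 : Integrable fun ζ => cauchyKernelApprox ε (ζ - z) • dbar g ζ := by
      refine hint.norm.mono' (hk'.continuous.aestronglyMeasurable.smul hm)
        (Eventually.of_forall fun ζ => ?_)
      rw [norm_smul, norm_smul, norm_inv]
      gcongr
      exact norm_cauchyKernelApprox_le _ _
    have hi2 : Integrable fun ζ => ((2 * ε ^ 2 / (‖ζ - z‖ ^ 2 + ε ^ 2) ^ 2 : ℝ) : ℂ) • g ζ := by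
      refine Continuous.integrable_of_hasCompactSupport ?_ ?_
      · refine Continuous.smul (continuous_ofReal.comp ?_) hc
        refine Continuous.div (by fun_prop) (by fun_prop) fun ζ => ?_
        positivity
      · refine HasCompactSupport.smul_left ?_
        exact HasCompactSupport.intro (isCompact_closedBall 0 R)
          fun w hw => hs w (by simpa using (not_le.1 (by simpa using hw)).le)
    have hprod : ∀ ζ, ζ ≠ 0 → dbar (fun ζ => cauchyKernelApprox ε (ζ - z) • g ζ) ζ =
        cauchyKernelApprox ε (ζ - z) • dbar g ζ +
          ((2 * ε ^ 2 / (‖ζ - z‖ ^ 2 + ε ^ 2) ^ 2 : ℝ) : ℂ) • g ζ := fun ζ hζ => by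
      rw [dbar_smul (hk' ζ) (hd ζ hζ), hdk]
    have hae : dbar (fun ζ => cauchyKernelApprox ε (ζ - z) • g ζ) =ᵐ[volume] fun ζ =>
        cauchyKernelApprox ε (ζ - z) • dbar g ζ +
          ((2 * ε ^ 2 / (‖ζ - z‖ ^ 2 + ε ^ 2) ^ 2 : ℝ) : ℂ) • g ζ := by
      filter_upwards [compl_mem_ae_iff.2 (measure_singleton (0 : ℂ))] with ζ hζ
      exact hprod ζ hζ
    have h0 := integral_dbar_eq_zero (f := fun ζ => cauchyKernelApprox ε (ζ - z) • g ζ) hR0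
      (hk'.continuous.smul hc) (fun ζ h => by simp [hs ζ h])
      (fun ζ h => (hk' ζ).smul (hd ζ h)) ((integrable_congr hae).2 (hi1.add hi2))
    rw [integral_congr_ae hae, integral_add hi1 hi2, add_eq_zero_iff_eq_neg] at h0
    rw [h0, neg_inj]
    have h1 := integral_add_left_eq_self (μ := volume)
      (fun ζ => ((2 * ε ^ 2 / (‖ζ - z‖ ^ 2 + ε ^ 2) ^ 2 : ℝ) : ℂ) • g ζ) z
    have h2 := Measure.integral_comp_smul (volume : Measure ℂ)
      (fun ζ => ((2 * ε ^ 2 / (‖z + ζ - z‖ ^ 2 + ε ^ 2) ^ 2 : ℝ) : ℂ) • g (z + ζ)) ε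
    rw [h1] at h2
    simp only [finrank_real_complex] at h2
    have hε2 : |(ε ^ 2)⁻¹| = (ε ^ 2)⁻¹ := abs_of_pos (by positivity)
    rw [hε2, eq_inv_smul_iff₀ (by positivity), ← integral_smul] at h2
    rw [← h2]
    congr 1
    ext w
    rw [add_sub_cancel_left, coe_smul, smul_smul, norm_smul, Real.norm_of_nonneg hε.le]
    congr 1
    field_simp
    ring
  have hnot : (𝓝[>] (0 : ℝ)) ≤ 𝓝 0 := nhdsWithin_le_nhds
  have lim1 : Tendsto (fun ε : ℝ => ∫ ζ, cauchyKernelApprox ε (ζ - z) • dbar g ζ) (𝓝[>] 0)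
      (𝓝 (∫ ζ, (ζ - z)⁻¹ • dbar g ζ)) := by
    refine tendsto_integral_filter_of_dominated_convergence (fun ζ => ‖(ζ - z)⁻¹ • dbar g ζ‖)
      ?_ ?_ hint.norm ?_
    · filter_upwards [self_mem_nhdsWithin] with ε hε
      have hk : Continuous fun ζ => cauchyKernelApprox ε (ζ - z) :=
        ((differentiable_cauchyKernelApprox (ne_of_gt hε)).continuous).comp (by fun_prop)
      exact hk.aestronglyMeasurable.smul hm
    · refine Eventually.of_forall fun ε => Eventually.of_forall fun ζ => ?_
      rw [norm_smul, norm_smul, norm_inv]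
      gcongr
      exact norm_cauchyKernelApprox_le _ _
    · exact Eventually.of_forall fun ζ =>
        ((tendsto_cauchyKernelApprox (ζ - z)).mono_left hnot).smul_const _
  have lim2 : Tendsto (fun ε : ℝ => ∫ w : ℂ, (2 / (1 + ‖w‖ ^ 2) ^ 2 : ℝ) • g (z + ε • w)) (𝓝[>] 0)
      (𝓝 (∫ w : ℂ, (2 / (1 + ‖w‖ ^ 2) ^ 2 : ℝ) • g z)) := by
    refine tendsto_integral_filter_of_dominated_convergence
      (fun w => (2 / (1 + ‖w‖ ^ 2) ^ 2 : ℝ) * B)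
      ?_ ?_ (integrable_pompeiuConst.mul_const B) ?_
    · refine Eventually.of_forall fun ε => ?_
      have hcont : Continuous fun w : ℂ => (2 / (1 + ‖w‖ ^ 2) ^ 2 : ℝ) :=
        Continuous.div (by fun_prop) (by fun_prop) fun ζ => by positivity
      exact (hcont.smul (hc.comp (by fun_prop))).aestronglyMeasurable
    · refine Eventually.of_forall fun ε => Eventually.of_forall fun w => ?_
      rw [norm_smul, Real.norm_of_nonneg (by positivity)]
      gcongr
      exact hB _
    · refine Eventually.of_forall fun w => ?_
      refine Tendsto.const_smul ?_ _
      have : Tendsto (fun ε : ℝ => g (z + ε • w)) (𝓝 0) (𝓝 (g (z + (0 : ℝ) • w))) :=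
        Continuous.tendsto (hc.comp (by fun_prop)) _
      rw [zero_smul, add_zero] at this
      exact this.mono_left hnot
  have heq := tendsto_nhds_unique (lim1.congr' (by
    filter_upwards [self_mem_nhdsWithin] with ε hε using key ε hε)) lim2.neg
  rw [integral_smul_const] at heq
  rw [heq, neg_neg]
  rfl

/-- The Cauchy-Pompeiu formula for compactly supported functions with a singularity of order at
most `|z| ^ (-1 / 2)` at the origin. -/
theorem pompeiu_formula_of_singular [FiniteDimensional ℂ E] {f : ℂ → E} {R A C : ℝ}
    (hs : ∀ z, R ≤ ‖z‖ → f z = 0)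
    (hd : ∀ z, z ≠ 0 → DifferentiableAt ℝ f z)
    (hfb : ∀ z, z ≠ 0 → ‖f z‖ ≤ A * (√‖z‖)⁻¹) (hC : 0 ≤ C)
    (hb : ∀ z, z ≠ 0 → ‖dbar f z‖ ≤ C * (√‖z‖)⁻¹) (z : ℂ) (hz0 : z ≠ 0) (hz : ‖z‖ < R) :
    pompeiuConst • f z = -∫ ζ, (ζ - z)⁻¹ • dbar f ζ := by
  have hR0 : 0 < R := (norm_nonneg z).trans_lt hz
  set g : ℂ → E := fun w => w • f w with hg
  have hgd : ∀ w, w ≠ 0 → DifferentiableAt ℝ g w := fun w hw =>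
    differentiableAt_id.smul (hd w hw)
  have hnw : ∀ w : ℂ, w ≠ 0 → ‖w‖ * (√‖w‖)⁻¹ = √‖w‖ := fun w hw => by
    have h : 0 < ‖w‖ := norm_pos_iff.2 hw
    have : 0 < √‖w‖ := Real.sqrt_pos.2 h
    rw [← div_eq_mul_inv, div_eq_iff this.ne', Real.mul_self_sqrt h.le]
  have hgc : Continuous g := by
    rw [continuous_iff_continuousAt]
    intro w
    by_cases hw : w = 0
    · subst hw
      have h1 : Tendsto (fun w : ℂ => A * √‖w‖) (𝓝 0) (𝓝 0) := by
        have : Continuous fun w : ℂ => A * √‖w‖ := by fun_prop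
        simpa using this.tendsto 0
      have h2 : Tendsto g (𝓝 0) (𝓝 0) := by
        refine squeeze_zero_norm (fun w => ?_) h1
        by_cases hw : w = 0
        · simp [hg, hw]
        · simp only [hg, norm_smul]
          rw [← hnw w hw]
          calc ‖w‖ * ‖f w‖ ≤ ‖w‖ * (A * (√‖w‖)⁻¹) := by gcongr; exact hfb w hw
            _ = _ := by ring
      simpa [ContinuousAt, hg] using h2
    · exact (hgd w hw).continuousAt
  have hgdb : ∀ w, w ≠ 0 → dbar g w = w • dbar f w := fun w hw => by
    rw [hg, dbar_smul (f := fun w => w) differentiableAt_id (hd w hw),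
      dbar_eq_zero_of_differentiableAt (f := fun w => w) differentiableAt_id]
    simp
  have hbz : ∀ w, R < ‖w‖ → dbar f w = 0 := fun w hw => dbar_eq_zero_of_support hs hw
  have hgb : ∀ w, w ≠ 0 → ‖dbar g w‖ ≤ C * √R := fun w hw => by
    rw [hgdb w hw, norm_smul]
    by_cases hwR : R < ‖w‖
    · rw [hbz w hwR]; simp; positivity
    · calc ‖w‖ * ‖dbar f w‖ ≤ ‖w‖ * (C * (√‖w‖)⁻¹) := by gcongr; exact hb w hw
        _ = C * (‖w‖ * (√‖w‖)⁻¹) := by ring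
        _ = C * √‖w‖ := by rw [hnw w hw]
        _ ≤ _ := by
          gcongr
          exact not_lt.1 hwR
  have hgs : ∀ w, R ≤ ‖w‖ → g w = 0 := fun w hw => by simp [hg, hs w hw]
  have p0 := pompeiu_formula hgc hgs hgd (by positivity) hgb 0 (by simpa)
  have p1 := pompeiu_formula hgc hgs hgd (by positivity) hgb z hz
  have hm := aestronglyMeasurable_dbar f
  have hz1 : ‖z‖ < R + 1 := by linarith
  have hi := integrable_cauchy_smul (R := R + 1) hm (fun ζ h => hbz ζ (by linarith)) hC hb hz1
  have e0 : ∫ ζ, (ζ - 0)⁻¹ • dbar g ζ = ∫ ζ, dbar f ζ := by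
    refine integral_congr_ae ?_
    filter_upwards [compl_mem_ae_iff.2 (measure_singleton (0 : ℂ))] with ζ hζ
    rw [hgdb ζ hζ, sub_zero, smul_smul, inv_mul_cancel₀ hζ, one_smul]
  have hiD' : Integrable (dbar f) := by
    refine (((integrable_cutKernel R).const_mul (C * R))).mono' hm ?_
    filter_upwards [compl_mem_ae_iff.2 (measure_singleton (0 : ℂ))] with ζ hζ
    by_cases hwR : R < ‖ζ‖
    · rw [hbz ζ hwR]; simp; exact mul_nonneg (by positivity) (cutKernel_nonneg _ _)
    have hwR := not_lt.1 hwR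
    rw [cutKernel_of_lt (by linarith)]
    have h0 : 0 < ‖ζ‖ := norm_pos_iff.2 hζ
    have h00 : 0 < √‖ζ‖ := Real.sqrt_pos.2 h0
    calc ‖dbar f ζ‖ ≤ C * (√‖ζ‖)⁻¹ := hb ζ hζ
      _ = C * (‖ζ‖ * (√‖ζ‖)⁻¹ ^ 2) * (√‖ζ‖)⁻¹ := by
        rw [inv_sq_sqrt, mul_inv_cancel₀ h0.ne', mul_one]
      _ ≤ C * (R * (√‖ζ‖)⁻¹ ^ 2) * (√‖ζ‖)⁻¹ := by gcongr
      _ = _ := by ring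
  have e1 : ∫ ζ, (ζ - z)⁻¹ • dbar g ζ = (∫ ζ, dbar f ζ) + z • ∫ ζ, (ζ - z)⁻¹ • dbar f ζ := by
    have hi' : Integrable fun ζ => z • (ζ - z)⁻¹ • dbar f ζ := hi.smul z
    rw [← integral_smul, ← integral_add hiD' hi']
    refine integral_congr_ae ?_
    filter_upwards [compl_mem_ae_iff.2 (measure_singleton (0 : ℂ)),
        compl_mem_ae_iff.2 (measure_singleton z)] with ζ hζ hζz
    have hζz' : ζ - z ≠ 0 := sub_ne_zero.2 hζz
    rw [hgdb ζ hζ, smul_smul, smul_smul]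
    nth_rw 2 [← one_smul ℂ (dbar f ζ)]
    rw [← add_smul]
    congr 1
    field_simp
    ring
  rw [e0] at p0
  have p0' : ∫ ζ, dbar f ζ = 0 := by simpa [hg] using p0
  rw [e1, p0', zero_add, hg] at p1
  simp only at p1
  rw [smul_comm, ← smul_neg] at p1
  exact smul_right_injective E hz0 p1

end PompeiuFormula

theorem norm_le_inv_sqrt_of_bounded {E : Type*} [NormedAddCommGroup E] {R M : ℝ} {H : ℂ → E}
    (hM0 : 0 ≤ M) (hs : ∀ z, R ≤ ‖z‖ → H z = 0)
    (hM : ∀ z, z ≠ 0 → ‖H z‖ ≤ M) {z : ℂ} (hz : z ≠ 0) : ‖H z‖ ≤ M * √R * (√‖z‖)⁻¹ := by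
  by_cases hzR : R ≤ ‖z‖
  · rw [hs z hzR]; simp; positivity
  have h1 : 0 < √‖z‖ := Real.sqrt_pos.2 (norm_pos_iff.2 hz)
  have h2 : √‖z‖ ≤ √R := Real.sqrt_le_sqrt (not_le.1 hzR).le
  have h3 : 1 ≤ √R * (√‖z‖)⁻¹ := by
    rw [← div_eq_mul_inv, one_le_div h1]; exact h2
  rw [mul_assoc]
  exact (hM z hz).trans (le_mul_of_one_le_right hM0 h3)

section Similarity

variable {E : Type*} [NormedAddCommGroup E] [NormedSpace ℂ E] [FiniteDimensional ℂ E]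

theorem exists_bound_of_singular {H : ℂ → E} {R K A M : ℝ} (hR : 0 < R)
    (hs : ∀ z, R / 2 ≤ ‖z‖ → H z = 0) (hd : ∀ z, z ≠ 0 → DifferentiableAt ℝ H z)
    (hK : 0 ≤ K) (hA : 0 ≤ A) (hb : ∀ z, z ≠ 0 → ‖dbar H z‖ ≤ K * ‖H z‖ + A) (hM0 : 0 ≤ M)
    (hM : ∀ z, z ≠ 0 → ‖H z‖ ≤ M * (√‖z‖)⁻¹) : ∃ M', 0 ≤ M' ∧ ∀ z, z ≠ 0 → ‖H z‖ ≤ M' := by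
  have hsR : ∀ z, R ≤ ‖z‖ → H z = 0 := fun z hz => hs z (by linarith)
  have hz : ∀ z, R ≤ ‖z‖ → dbar H z = 0 := fun z hz =>
    dbar_eq_zero_of_support hs (by linarith)
  have hC : 0 ≤ K * M + A * √R := by positivity
  have hb' : ∀ z, z ≠ 0 → ‖dbar H z‖ ≤ (K * M + A * √R) * (√‖z‖)⁻¹ := fun z h0 => by
    by_cases hzR : R ≤ ‖z‖
    · rw [hz z hzR]; simp; positivity
    have h1 : 0 < √‖z‖ := Real.sqrt_pos.2 (norm_pos_iff.2 h0)
    have h2 : √‖z‖ ≤ √R := Real.sqrt_le_sqrt (not_le.1 hzR).le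
    have h3 : 1 ≤ √R * (√‖z‖)⁻¹ := by
      rw [← div_eq_mul_inv, one_le_div h1]; exact h2
    calc ‖dbar H z‖ ≤ K * ‖H z‖ + A := hb z h0
      _ ≤ K * (M * (√‖z‖)⁻¹) + A * (√R * (√‖z‖)⁻¹) := by
        gcongr
        · exact hM z h0
        · exact le_mul_of_one_le_right hA h3
      _ = _ := by ring
  have hI : 0 ≤ ∫ w, cutKernel R w := integral_nonneg (cutKernel_nonneg R)
  refine ⟨2 * (K * M + A * √R) * (∫ w, cutKernel R w) / pompeiuConst,
    div_nonneg (by positivity) pompeiuConst_pos.le, fun z h0 => ?_⟩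
  by_cases hzR : R ≤ ‖z‖
  · rw [hsR z hzR, norm_zero]
    exact div_nonneg (by positivity) pompeiuConst_pos.le
  have hzR := not_le.1 hzR
  have hp := pompeiu_formula_of_singular hsR hd hM hC hb' z h0 hzR
  rw [le_div_iff₀ pompeiuConst_pos]
  have := norm_integral_cauchy_smul_le hz hC hb' hzR
  rw [← norm_neg, ← hp, norm_smul, Real.norm_of_nonneg pompeiuConst_pos.le] at this
  linarith

theorem exists_limit_of_bounded {H : ℂ → E} {R K A M : ℝ} (hR : 0 < R)
    (hs : ∀ z, R / 2 ≤ ‖z‖ → H z = 0) (hd : ∀ z, z ≠ 0 → DifferentiableAt ℝ H z)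
    (hK : 0 ≤ K) (hA : 0 ≤ A) (hb : ∀ z, z ≠ 0 → ‖dbar H z‖ ≤ K * ‖H z‖ + A) (hM0 : 0 ≤ M)
    (hM : ∀ z, z ≠ 0 → ‖H z‖ ≤ M) :
    ∃ (c : E) (C : ℝ), 0 ≤ C ∧ ∀ z, z ≠ 0 → ‖z‖ < R → ‖H z - c‖ ≤ C * √‖z‖ := by
  have hsR : ∀ z, R ≤ ‖z‖ → H z = 0 := fun z hz => hs z (by linarith)
  have hz : ∀ z, R ≤ ‖z‖ → dbar H z = 0 := fun z hz =>
    dbar_eq_zero_of_support hs (by linarith)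
  have hC0 : 0 ≤ K * M + A := by positivity
  have hC : 0 ≤ (K * M + A) * √R := by positivity
  have hdb : ∀ z, z ≠ 0 → ‖dbar H z‖ ≤ K * M + A := fun z h0 => (hb z h0).trans (by
    gcongr; exact hM z h0)
  have hb' : ∀ z, z ≠ 0 → ‖dbar H z‖ ≤ (K * M + A) * √R * (√‖z‖)⁻¹ := fun z h0 =>
    norm_le_inv_sqrt_of_bounded hC0 hz hdb h0
  have hM' : ∀ z, z ≠ 0 → ‖H z‖ ≤ M * √R * (√‖z‖)⁻¹ := fun z h0 =>
    norm_le_inv_sqrt_of_bounded hM0 hsR hM h0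
  have hI : 0 ≤ ∫ w, cutKernel R w := integral_nonneg (cutKernel_nonneg R)
  refine ⟨-(pompeiuConst⁻¹ • ∫ ζ, ζ⁻¹ • dbar H ζ),
    pompeiuConst⁻¹ * (4 * (K * M + A) * ∫ w, cutKernel R w),
    mul_nonneg (inv_nonneg.2 pompeiuConst_pos.le) (by positivity), fun z h0 hzR => ?_⟩
  have hp := pompeiu_formula_of_singular hsR hd hM' hC hb' z h0 hzR
  rw [← inv_smul_smul₀ pompeiuConst_pos.ne' (H z), hp, ← smul_neg, ← smul_sub, norm_smul, norm_inv,
    Real.norm_of_nonneg pompeiuConst_pos.le, neg_sub_neg, norm_sub_rev, mul_assoc]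
  refine mul_le_mul_of_nonneg_left ?_ (inv_nonneg.2 pompeiuConst_pos.le)
  exact norm_integral_cauchy_smul_sub_le (aestronglyMeasurable_dbar H) hz hC0 hdb hzR

theorem norm_le_of_small {H : ℂ → E} {R K A M : ℝ} (hR : 0 < R)
    (hs : ∀ z, R / 2 ≤ ‖z‖ → H z = 0) (hd : ∀ z, z ≠ 0 → DifferentiableAt ℝ H z)
    (hK : 0 ≤ K) (hA : 0 ≤ A) (hb : ∀ z, z ≠ 0 → ‖dbar H z‖ ≤ K * ‖H z‖ + A)
    (hM : ∀ z, z ≠ 0 → ‖H z‖ ≤ M)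
    (hsmall : K * (√(2 * R) * (∫ w, cutKernel R w) / pompeiuConst) ≤ 1 / 2) {z : ℂ}
    (hz0 : z ≠ 0) : ‖H z‖ ≤ 2 * A * (√(2 * R) * (∫ w, cutKernel R w) / pompeiuConst) := by
  set κ := √(2 * R) * (∫ w, cutKernel R w) / pompeiuConst with hκ
  have hI : 0 ≤ ∫ w, cutKernel R w := integral_nonneg (cutKernel_nonneg R)
  have hκ0 : 0 ≤ κ := div_nonneg (by positivity) pompeiuConst_pos.le
  have hsR : ∀ z, R ≤ ‖z‖ → H z = 0 := fun z hz => hs z (by linarith)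
  have hz : ∀ z, R ≤ ‖z‖ → dbar H z = 0 := fun z hz =>
    dbar_eq_zero_of_support hs (by linarith)
  let S : ℝ := ⨆ w : {w : ℂ // w ≠ 0}, ‖H w‖
  have hbdd : BddAbove (range fun w : {w : ℂ // w ≠ 0} => ‖H w‖) :=
    ⟨M, by rintro _ ⟨w, rfl⟩; exact hM w w.2⟩
  have hle : ∀ w, w ≠ 0 → ‖H w‖ ≤ S := fun w hw => le_ciSup hbdd ⟨w, hw⟩
  have hS0 : 0 ≤ S := (norm_nonneg _).trans (hle z hz0)
  have hdb : ∀ z, z ≠ 0 → ‖dbar H z‖ ≤ K * S + A := fun z h0 => (hb z h0).trans (by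
    gcongr; exact hle z h0)
  have hC0 : 0 ≤ K * S + A := by positivity
  have hstep : ∀ w, w ≠ 0 → ‖H w‖ ≤ (K * S + A) * κ := fun w hw => by
    by_cases hwR : R ≤ ‖w‖
    · rw [hsR w hwR, norm_zero]; positivity
    have hwR := not_le.1 hwR
    have hp := pompeiu_formula_of_singular hsR hd
      (fun z h => norm_le_inv_sqrt_of_bounded hS0 hsR hle h) (by positivity : 0 ≤ (K * S + A) * √R)
      (fun z h => norm_le_inv_sqrt_of_bounded hC0 hz hdb h) w hw hwR
    have := norm_integral_cauchy_smul_le_of_bounded hz hC0 hdb hwR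
    rw [← norm_neg, ← hp, norm_smul, Real.norm_of_nonneg pompeiuConst_pos.le] at this
    rw [hκ, ← mul_div_assoc, le_div_iff₀ pompeiuConst_pos]
    linarith
  have : Nonempty {w : ℂ // w ≠ 0} := ⟨⟨z, hz0⟩⟩
  have hSle : S ≤ (K * S + A) * κ := ciSup_le fun w => hstep w w.2
  have : K * κ * S ≤ 1 / 2 * S := by gcongr
  have := hle z hz0
  nlinarith

end Similarity

section SimilarityPrinciple

variable {E : Type*} [NormedAddCommGroup E] [NormedSpace ℂ E] [FiniteDimensional ℂ E]

omit [FiniteDimensional ℂ E] in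
theorem exists_cutoff_of_dbar_le {η : ℂ → E} {r K B R : ℝ} (hR0 : 0 < R) (hRr : R ≤ r)
    (hK : 0 ≤ K)
    (hd : ∀ z, z ≠ 0 → ‖z‖ < r → DifferentiableAt ℝ η z)
    (hB : ∀ z, z ≠ 0 → ‖z‖ < r → ‖η z‖ ≤ B)
    (hb : ∀ z, z ≠ 0 → ‖z‖ < r → ‖dbar η z‖ ≤ K * ‖η z‖) :
    ∃ (G : ℂ → E) (A : ℝ), 0 ≤ A ∧ (∀ z, ‖z‖ < R / 4 → G z = η z) ∧
      (∀ z, R / 2 ≤ ‖z‖ → G z = 0) ∧ (∀ z, z ≠ 0 → DifferentiableAt ℝ G z) ∧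
      (∀ z, z ≠ 0 → ‖G z‖ ≤ max B 0) ∧
      (∀ z, z ≠ 0 → ‖dbar G z‖ ≤ K * ‖G z‖ + A) ∧
      (∀ z, z ≠ 0 → ‖z‖ < R / 4 → ‖dbar G z‖ ≤ K * ‖G z‖) := by
  let χ : ContDiffBump (0 : ℂ) := ⟨R / 4, R / 2, by positivity, by linarith⟩
  let f : ℂ → ℂ := fun z => ((χ z : ℝ) : ℂ)
  have hf : ContDiff ℝ 1 f := ofRealCLM.contDiff.comp χ.contDiff
  have hf0 : ∀ z, R / 2 ≤ ‖z‖ → f z = 0 := fun z hz => by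
    simp only [f]; rw [χ.zero_of_le_dist (by simpa [χ] using hz)]; simp
  have hf1 : ∀ z, ‖z‖ < R / 4 → f z = 1 := fun z hz => by
    simp only [f]; rw [χ.one_of_mem_closedBall (by simpa [χ] using hz.le)]; simp
  have hfn : ∀ z, ‖f z‖ ≤ 1 := fun z => by
    simp only [f, norm_real, Real.norm_of_nonneg χ.nonneg]; exact χ.le_one
  have hfcs : HasCompactSupport f := HasCompactSupport.intro (isCompact_closedBall 0 (R / 2))
    fun w hw => hf0 w (by simpa using (not_le.1 (by simpa using hw)).le)
  obtain ⟨A₀, hA₀⟩ := (hfcs.fderiv (𝕜 := ℝ)).exists_bound_of_continuous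
    (hf.continuous_fderiv one_ne_zero)
  have hA₀0 : 0 ≤ A₀ := (norm_nonneg _).trans (hA₀ 0)
  have hdf : ∀ z, ‖dbar f z‖ ≤ 2 * A₀ := fun z => by
    refine (norm_add_le _ _).trans ?_
    rw [norm_smul, norm_I, one_mul]
    have h1 := (fderiv ℝ f z).le_opNorm 1
    have h2 := (fderiv ℝ f z).le_opNorm I
    rw [norm_one, mul_one] at h1
    rw [norm_I, mul_one] at h2
    linarith [hA₀ z]
  have hfd : Differentiable ℝ f := hf.differentiable one_ne_zero
  have hlt : ∀ {z : ℂ}, ‖z‖ ≤ R / 2 → ‖z‖ < r := fun h => by linarith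
  have hG0 : ∀ z, R / 2 ≤ ‖z‖ → f z • η z = 0 := fun z hz => by rw [hf0 z hz, zero_smul]
  have hdG : ∀ z, z ≠ 0 → ‖z‖ ≤ R / 2 → ‖dbar (fun w => f w • η w) z‖ ≤
      K * ‖f z • η z‖ + ‖dbar f z‖ * ‖η z‖ := fun z h0 hz => by
    rw [dbar_smul (hfd z) (hd z h0 (hlt hz))]
    refine (norm_add_le _ _).trans ?_
    rw [norm_smul, norm_smul, norm_smul]
    have := mul_le_mul_of_nonneg_left (hb z h0 (hlt hz)) (norm_nonneg (f z))
    linarith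
  refine ⟨fun z => f z • η z, 2 * A₀ * max B 0, by positivity, fun z hz => by
      simp [hf1 z hz], hG0, fun z h0 => ?_, fun z h0 => ?_, fun z h0 => ?_, fun z h0 hz => ?_⟩
  · by_cases hz : ‖z‖ ≤ R / 2
    · exact (hfd z).smul (hd z h0 (hlt hz))
    · have : (fun w => f w • η w) =ᶠ[𝓝 z] fun _ => 0 := by
        filter_upwards [(continuous_norm.isOpen_preimage _ isOpen_Ioi).mem_nhds (not_le.1 hz)]
          with w hw
        exact hG0 w (le_of_lt hw)
      exact (differentiableAt_const _).congr_of_eventuallyEq this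
  · by_cases hz : ‖z‖ ≤ R / 2
    · rw [norm_smul]
      exact (mul_le_of_le_one_left (norm_nonneg _) (hfn z)).trans
        ((hB z h0 (hlt hz)).trans (le_max_left _ _))
    · simp only [hG0 z (not_le.1 hz).le, norm_zero]; positivity
  · by_cases hz : ‖z‖ ≤ R / 2
    · refine (hdG z h0 hz).trans ?_
      gcongr
      · exact hdf z
      · exact (hB z h0 (hlt hz)).trans (le_max_left _ _)
    · rw [dbar_eq_zero_of_support hG0 (not_le.1 hz), norm_zero]; positivity
  · have h1 : f =ᶠ[𝓝 z] fun _ => 1 := by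
      filter_upwards [(continuous_norm.isOpen_preimage _ isOpen_Iio).mem_nhds hz] with w hw
      exact hf1 w hw
    have h2 : dbar f z = 0 := by simp [dbar, h1.fderiv_eq]
    have := hdG z h0 (by linarith)
    rwa [h2, norm_zero, zero_mul, add_zero] at this

omit [FiniteDimensional ℂ E] in
theorem dbar_inv_pow_smul {G : ℂ → E} {z : ℂ} (m : ℕ) (hz : z ≠ 0) (hG : DifferentiableAt ℝ G z) :
    DifferentiableAt ℝ (fun w => (w ^ m)⁻¹ • G w) z ∧
      dbar (fun w => (w ^ m)⁻¹ • G w) z = (z ^ m)⁻¹ • dbar G z := by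
  have h : DifferentiableAt ℂ (fun w : ℂ => (w ^ m)⁻¹) z :=
    (differentiableAt_id.pow m).inv (pow_ne_zero _ hz)
  refine ⟨(h.restrictScalars ℝ).smul hG, ?_⟩
  rw [dbar_smul (f := fun w : ℂ => (w ^ m)⁻¹) (h.restrictScalars ℝ) hG,
    dbar_eq_zero_of_differentiableAt h, zero_smul, add_zero]

/-- Solutions of the differential inequality `|∂̄η| ≤ K |η|` either vanish identically near `0`
or have a well defined nonzero leading term `c z ^ m`. -/
theorem eventually_eq_zero_or_exists_leading_term {η : ℂ → E} {r K B : ℝ} (hr : 0 < r)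
    (hK : 0 ≤ K)
    (hd : ∀ z, z ≠ 0 → ‖z‖ < r → DifferentiableAt ℝ η z)
    (hB : ∀ z, z ≠ 0 → ‖z‖ < r → ‖η z‖ ≤ B)
    (hb : ∀ z, z ≠ 0 → ‖z‖ < r → ‖dbar η z‖ ≤ K * ‖η z‖) :
    (∀ᶠ z in 𝓝[≠] 0, η z = 0) ∨
      ∃ (m : ℕ) (c : E), c ≠ 0 ∧ Tendsto (fun z => (z ^ m)⁻¹ • η z) (𝓝[≠] 0) (𝓝 c) := by
  obtain ⟨R, hR0, hRr, hR1, hRK⟩ : ∃ R : ℝ, 0 < R ∧ R ≤ r ∧ R ≤ 1 ∧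
      K * (√(2 * R) * (∫ w, cutKernel 1 w) / pompeiuConst) ≤ 1 / 2 := by
    have hc : Continuous fun R : ℝ => K * (√(2 * R) * (∫ w, cutKernel 1 w) / pompeiuConst) := by
      fun_prop
    have ht := hc.tendsto 0
    simp only [mul_zero, Real.sqrt_zero, zero_mul, zero_div] at ht
    have h1 := (ht.eventually (ge_mem_nhds (by norm_num : (0 : ℝ) < 1 / 2))).filter_mono
      (nhdsWithin_le_nhds (s := Ioi 0))
    have h2 : ∀ᶠ R : ℝ in 𝓝[>] 0, R ∈ Ioc 0 (min r 1) := Ioc_mem_nhdsGT (by positivity)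
    obtain ⟨R, h3, h4⟩ := (h1.and h2).exists
    exact ⟨R, h4.1, h4.2.trans (min_le_left _ _), h4.2.trans (min_le_right _ _), h3⟩
  have hsmall : K * (√(2 * R) * (∫ w, cutKernel R w) / pompeiuConst) ≤ 1 / 2 := by
    refine le_trans ?_ hRK
    gcongr
    · exact pompeiuConst_pos.le
    · exact integrable_cutKernel R
    · exact integrable_cutKernel 1
    · intro w; exact cutKernel_mono hR1 w
  obtain ⟨G, A, hA, hGη, hGs, hGd, hGB, hGA, hGK⟩ := exists_cutoff_of_dbar_le hR0 hRr hK hd hB hb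
  let F : ℕ → ℂ → E := fun m w => (w ^ m)⁻¹ • G w
  have hFs : ∀ m z, R / 2 ≤ ‖z‖ → F m z = 0 := fun m z hz => by simp [F, hGs z hz]
  have hFd : ∀ m z, z ≠ 0 → DifferentiableAt ℝ (F m) z := fun m z h0 =>
    (dbar_inv_pow_smul m h0 (hGd z h0)).1
  have hA' : ∀ m : ℕ, 0 ≤ A * ((R / 4) ^ m)⁻¹ := fun m => by positivity
  have hFb : ∀ m z, z ≠ 0 → ‖dbar (F m) z‖ ≤ K * ‖F m z‖ + A * ((R / 4) ^ m)⁻¹ :=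
    fun m z h0 => by
    have h1 : ‖dbar (F m) z‖ = ‖(z ^ m)⁻¹‖ * ‖dbar G z‖ := by
      rw [← norm_smul, ← (dbar_inv_pow_smul m h0 (hGd z h0)).2]
    have h2 : ‖F m z‖ = ‖(z ^ m)⁻¹‖ * ‖G z‖ := norm_smul _ _
    rw [h1, h2]
    by_cases hz : ‖z‖ < R / 4
    · have := mul_le_mul_of_nonneg_left (hGK z h0 hz) (norm_nonneg (z ^ m)⁻¹)
      linarith [hA' m]
    · have := mul_le_mul_of_nonneg_left (hGA z h0) (norm_nonneg (z ^ m)⁻¹)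
      have h3 : A * ‖(z ^ m)⁻¹‖ ≤ A * ((R / 4) ^ m)⁻¹ := by
        rw [norm_inv, norm_pow]
        gcongr
        exact not_lt.1 hz
      linarith
  by_cases hall : ∀ m, ∃ M, 0 ≤ M ∧ ∀ z, z ≠ 0 → ‖F m z‖ ≤ M
  · left
    have hball : ∀ᶠ z : ℂ in 𝓝[≠] 0, z ≠ 0 ∧ ‖z‖ < R / 4 := by
      refine (eventually_mem_nhdsWithin).and (Eventually.filter_mono nhdsWithin_le_nhds ?_)
      filter_upwards [ball_mem_nhds (0 : ℂ) (by positivity : 0 < R / 4)] with z hz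
      simpa using hz
    filter_upwards [hball] with z ⟨h0, hz⟩
    set κ := √(2 * R) * (∫ w, cutKernel R w) / pompeiuConst with hκ
    have key : ∀ m : ℕ, ‖η z‖ ≤ 2 * A * κ * (‖z‖ / (R / 4)) ^ m := fun m => by
      obtain ⟨M, hM0, hM⟩ := hall m
      have := norm_le_of_small hR0 (hFs m) (hFd m) hK (hA' m) (hFb m) hM hsmall h0
      rw [← hκ] at this
      have h2 : ‖F m z‖ = (‖z‖ ^ m)⁻¹ * ‖η z‖ := by
        simp only [F, norm_smul, norm_inv, norm_pow, hGη z hz]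
      have hz0 : 0 < ‖z‖ := norm_pos_iff.2 h0
      rw [h2, inv_mul_le_iff₀ (by positivity)] at this
      refine this.trans (le_of_eq ?_)
      rw [div_pow ‖z‖, div_eq_mul_inv (‖z‖ ^ m)]
      generalize ((R / 4) ^ m)⁻¹ = x
      ring
    have ht : Tendsto (fun m : ℕ => 2 * A * κ * (‖z‖ / (R / 4)) ^ m) atTop (𝓝 (2 * A * κ * 0)) :=
      (tendsto_pow_atTop_nhds_zero_of_lt_one (by positivity)
        ((div_lt_one (by positivity)).2 hz)).const_mul _
    rw [mul_zero] at ht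
    exact norm_le_zero_iff.1 (ge_of_tendsto' ht key)
  · right
    push Not at hall
    classical
    have hm := Nat.find_spec hall
    have hmin := fun k => @Nat.find_min _ _ hall k
    set m := Nat.find hall
    obtain ⟨k, hk⟩ : ∃ k, m = k + 1 := by
      refine Nat.exists_eq_succ_of_ne_zero fun h => ?_
      obtain ⟨z, h0, hz⟩ := hm (max B 0) (le_max_right _ _)
      rw [h] at hz
      have := hGB z h0
      simp only [F, pow_zero, inv_one, one_smul] at hz
      linarith
    have hkb := hmin k (by omega)
    push Not at hkb
    obtain ⟨M, hM0, hM⟩ := hkb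
    obtain ⟨c, C, hC, hcC⟩ :=
      exists_limit_of_bounded hR0 (hFs k) (hFd k) hK (hA' k) (hFb k) hM0 hM
    refine ⟨k, c, fun hc => ?_, ?_⟩
    · have hsing : ∀ z, z ≠ 0 → ‖F m z‖ ≤ C * (√‖z‖)⁻¹ := fun z h0 => by
        by_cases hz : R / 2 ≤ ‖z‖
        · rw [hFs m z hz, norm_zero]; positivity
        have h1 := hcC z h0 (by linarith [not_le.1 hz])
        rw [hc, sub_zero] at h1
        have h2 : ‖F m z‖ = ‖z‖⁻¹ * ‖F k z‖ := by
          simp only [F, norm_smul, norm_inv, norm_pow, hk, pow_succ, mul_inv, norm_mul]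
          ring
        have h3 : 0 < ‖z‖ := norm_pos_iff.2 h0
        have h4 : 0 < √‖z‖ := Real.sqrt_pos.2 h3
        rw [h2, ← inv_sq_sqrt]
        calc (√‖z‖)⁻¹ ^ 2 * ‖F k z‖ ≤ (√‖z‖)⁻¹ ^ 2 * (C * √‖z‖) := by gcongr
          _ = _ := by field_simp
      obtain ⟨M', hM'0, hM'⟩ :=
        exists_bound_of_singular hR0 (hFs m) (hFd m) hK (hA' m) (hFb m) hC hsing
      obtain ⟨z, h0, hz⟩ := hm M' hM'0
      exact absurd (hM' z h0) (not_le.2 hz)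
    · have hball : ∀ᶠ z : ℂ in 𝓝[≠] 0, z ≠ 0 ∧ ‖z‖ < R / 4 := by
        refine (eventually_mem_nhdsWithin).and (Eventually.filter_mono nhdsWithin_le_nhds ?_)
        filter_upwards [ball_mem_nhds (0 : ℂ) (by positivity : 0 < R / 4)] with z hz
        simpa using hz
      have ht : Tendsto (F k) (𝓝[≠] 0) (𝓝 c) := by
        rw [tendsto_iff_norm_sub_tendsto_zero]
        have hs : Tendsto (fun z : ℂ => C * √‖z‖) (𝓝[≠] 0) (𝓝 0) := by
          have : Continuous fun w : ℂ => C * √‖w‖ := by fun_prop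
          have := (this.tendsto 0).mono_left (nhdsWithin_le_nhds (s := {0}ᶜ))
          simpa using this
        refine squeeze_zero' (Eventually.of_forall fun _ => norm_nonneg _) ?_ hs
        filter_upwards [hball] with z ⟨h0, hz⟩
        exact hcC z h0 (by linarith)
      refine ht.congr' ?_
      filter_upwards [hball] with z ⟨h0, hz⟩
      simp only [F, hGη z hz]

end SimilarityPrinciple

section LeadingTerm

variable {E : Type*} [NormedAddCommGroup E] [NormedSpace ℂ E]

/-- `u` agrees with `z ^ k • b` near the origin, up to first order derivatives. -/
def HasLeadingTerm (u : ℂ → E) (k : ℕ) (b : E) : Prop :=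
  ∀ ε : ℝ, 0 < ε → ∀ᶠ z in 𝓝 (0 : ℂ),
    (∀ ξ : ℂ, ‖fderiv ℝ u z ξ - ((k : ℂ) * z ^ (k - 1) * ξ) • b‖ ≤ ε * ‖z‖ ^ (k - 1) * ‖ξ‖) ∧
      ‖u z - z ^ k • b‖ ≤ ε * ‖z‖ ^ k

omit [NormedSpace ℂ E] in
theorem eventually_nhds_of_punctured {f : ℂ → E} {g : ℂ → ℝ} (hf : ContinuousAt f 0)
    (hg : ContinuousAt g 0) (h : ∀ᶠ z in 𝓝[≠] (0 : ℂ), ‖f z‖ ≤ g z) :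
    ∀ᶠ z in 𝓝 (0 : ℂ), ‖f z‖ ≤ g z := by
  have h0 : ‖f 0‖ ≤ g 0 := le_of_tendsto_of_tendsto
    ((hf.norm.tendsto).mono_left nhdsWithin_le_nhds) (hg.tendsto.mono_left nhdsWithin_le_nhds) h
  rw [eventually_nhdsWithin_iff] at h
  filter_upwards [h] with z hz
  by_cases hz0 : z = 0
  · rw [hz0]; exact h0
  · exact hz hz0

theorem eventually_norm_sub_le_of_tendsto {p : ℂ → E} {m : ℕ} {b : E} (hp : ContinuousAt p 0)
    (h : Tendsto (fun z => (z ^ m)⁻¹ • p z) (𝓝[≠] 0) (𝓝 b)) {ε : ℝ} (hε : 0 < ε) :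
    ∀ᶠ z in 𝓝 (0 : ℂ), ‖p z - z ^ m • b‖ ≤ ε * ‖z‖ ^ m := by
  refine eventually_nhds_of_punctured (f := fun z => p z - z ^ m • b)
    (g := fun z => ε * ‖z‖ ^ m) (hp.sub (by fun_prop)) (by fun_prop) ?_
  have h1 := h.eventually (ball_mem_nhds b hε)
  filter_upwards [h1, self_mem_nhdsWithin] with z hz hz0
  have hz0 : z ≠ 0 := hz0
  have : p z - z ^ m • b = z ^ m • ((z ^ m)⁻¹ • p z - b) := by
    rw [smul_sub, smul_inv_smul₀ (pow_ne_zero _ hz0)]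
  rw [this, norm_smul, norm_pow, mul_comm]
  gcongr
  exact (mem_ball_iff_norm.1 hz).le

theorem norm_le_of_fderiv_le {g : ℂ → E} {ε δ : ℝ} {m : ℕ} (hε : 0 ≤ ε)
    (hd : ∀ z ∈ ball (0 : ℂ) δ, DifferentiableAt ℝ g z)
    (hb : ∀ z ∈ ball (0 : ℂ) δ, ∀ ξ, ‖fderiv ℝ g z ξ‖ ≤ ε * ‖z‖ ^ m * ‖ξ‖) (h0 : g 0 = 0)
    {z : ℂ} (hz : z ∈ ball (0 : ℂ) δ) : ‖g z‖ ≤ ε * ‖z‖ ^ (m + 1) := by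
  have hsub : ∀ w ∈ closedBall (0 : ℂ) ‖z‖, w ∈ ball (0 : ℂ) δ ∧ ‖w‖ ≤ ‖z‖ := fun w hw => by
    rw [mem_closedBall_zero_iff] at hw
    rw [mem_ball_zero_iff] at hz ⊢
    exact ⟨hw.trans_lt hz, hw⟩
  have := (convex_closedBall (0 : ℂ) ‖z‖).norm_image_sub_le_of_norm_fderiv_le (𝕜 := ℝ) (f := g)
    (C := ε * ‖z‖ ^ m) (fun w hw => hd w (hsub w hw).1)
    (fun w hw => ContinuousLinearMap.opNorm_le_bound _ (by positivity) fun ξ =>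
      (hb w (hsub w hw).1 ξ).trans (by gcongr; exact (hsub w hw).2))
    (x := 0) (y := z) (by simp) (by simp)
  rw [h0, sub_zero, sub_zero] at this
  rw [pow_succ, ← mul_assoc]
  exact this

theorem fderiv_apply_eq_re_im (A : ℂ →L[ℝ] E) (ξ : ℂ) : A ξ = ξ.re • A 1 + ξ.im • A I := by
  conv_lhs => rw [← Complex.re_add_im ξ]
  have h1 : (ξ.re : ℂ) = ξ.re • (1 : ℂ) := by simp
  have h2 : (ξ.im : ℂ) * I = ξ.im • I := by simp
  rw [map_add, h1, h2, map_smul, map_smul]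

theorem complex_smul_eq_re_im (ξ : ℂ) (x : E) : ξ • x = ξ.re • x + ξ.im • I • x := by
  conv_lhs => rw [← Complex.re_add_im ξ]
  rw [add_smul, mul_smul, Complex.coe_smul, Complex.coe_smul]

theorem hasLeadingTerm_of_tendsto {u : ℂ → E} {J : E → E →L[ℝ] E} (hJ : ContinuousAt J 0)
    (hJ0 : ∀ w, J 0 w = I • w) (hu : ContDiffAt ℝ 1 u 0) (hu0 : u 0 = 0)
    (hCR : ∀ᶠ z in 𝓝 (0 : ℂ), fderiv ℝ u z I = J (u z) (fderiv ℝ u z 1)) {m : ℕ} {b : E}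
    (h : Tendsto (fun z => (z ^ m)⁻¹ • fderiv ℝ u z 1) (𝓝[≠] 0) (𝓝 b)) :
    HasLeadingTerm u (m + 1) ((m + 1 : ℂ)⁻¹ • b) := by
  intro ε hε
  have hp : ContinuousAt (fun z => fderiv ℝ u z 1) 0 :=
    (hu.continuousAt_fderiv one_ne_zero).clm_apply continuousAt_const
  have hm : ((m : ℂ) + 1) ≠ 0 := by exact_mod_cast m.succ_ne_zero
  have hcoef : ∀ z ξ : ℂ, (((m + 1 : ℕ) : ℂ) * z ^ (m + 1 - 1) * ξ) • (m + 1 : ℂ)⁻¹ • b =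
      (ξ * z ^ m) • b := fun z ξ => by
    rw [smul_smul]; congr 1; push_cast; field_simp
  have hd : ∀ᶠ z in 𝓝 (0 : ℂ), ∀ ξ : ℂ, ‖fderiv ℝ u z ξ - (ξ * z ^ m) • b‖ ≤
      ε * ‖z‖ ^ m * ‖ξ‖ := by
    have hJu : Tendsto (fun z => ‖J (u z) - J 0‖ * (‖b‖ + 1)) (𝓝 0) (𝓝 0) := by
      have h1 : ContinuousAt (fun z => ‖J (u z) - J 0‖ * (‖b‖ + 1)) 0 := by
        have : ContinuousAt (fun z => J (u z)) 0 :=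
          ContinuousAt.comp (f := u) (by rwa [hu0]) hu.continuousAt
        exact (this.sub continuousAt_const).norm.mul continuousAt_const
      simpa [ContinuousAt, hu0] using h1
    filter_upwards [hCR, eventually_norm_sub_le_of_tendsto hp h (half_pos hε),
      eventually_norm_sub_le_of_tendsto hp h one_pos,
      hJu.eventually (ge_mem_nhds (half_pos hε))] with z h1 h2 h3 h4 ξ
    set p := fderiv ℝ u z 1
    have hpn : ‖p‖ ≤ (‖b‖ + 1) * ‖z‖ ^ m := by
      have := norm_add_le (p - z ^ m • b) (z ^ m • b)
      rw [sub_add_cancel, norm_smul, norm_pow] at this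
      linarith
    have e : fderiv ℝ u z ξ - (ξ * z ^ m) • b =
        ξ • (p - z ^ m • b) + ξ.im • (J (u z) - J 0) p := by
      rw [fderiv_apply_eq_re_im (fderiv ℝ u z) ξ, h1, smul_sub, complex_smul_eq_re_im ξ p,
        mul_smul, sub_apply, hJ0, smul_sub]
      abel
    rw [e]
    calc _ ≤ ‖ξ‖ * ‖p - z ^ m • b‖ + |ξ.im| * (‖J (u z) - J 0‖ * ‖p‖) := by
          refine (norm_add_le _ _).trans ?_
          rw [norm_smul, norm_smul, Real.norm_eq_abs]
          gcongr
          exact ContinuousLinearMap.le_opNorm _ _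
      _ ≤ ‖ξ‖ * (ε / 2 * ‖z‖ ^ m) + ‖ξ‖ * (‖J (u z) - J 0‖ * ((‖b‖ + 1) * ‖z‖ ^ m)) := by
        gcongr
        exact abs_im_le_norm ξ
      _ = ‖ξ‖ * (ε / 2 * ‖z‖ ^ m) + ‖ξ‖ * (‖J (u z) - J 0‖ * (‖b‖ + 1)) * ‖z‖ ^ m := by ring
      _ ≤ ‖ξ‖ * (ε / 2 * ‖z‖ ^ m) + ‖ξ‖ * (ε / 2) * ‖z‖ ^ m := by gcongr
      _ = _ := by ring
  have hdiff : ∀ᶠ z in 𝓝 (0 : ℂ), DifferentiableAt ℝ u z := by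
    filter_upwards [hu.eventually (by simp)] with z hz using hz.differentiableAt one_ne_zero
  obtain ⟨δ, hδ, hball⟩ := Metric.eventually_nhds_iff_ball.1 (hd.and hdiff)
  filter_upwards [ball_mem_nhds (0 : ℂ) hδ] with z hz
  refine ⟨fun ξ => ?_, ?_⟩
  · rw [hcoef]
    simpa using (hball z hz).1 ξ
  · have hpow : ∀ w : ℂ, HasFDerivAt (fun w : ℂ => w ^ (m + 1) • (m + 1 : ℂ)⁻¹ • b)
        ((((((m + 1 : ℕ) : ℂ) * w ^ (m + 1 - 1)) •
          (1 : ℂ →L[ℂ] ℂ)).smulRight ((m + 1 : ℂ)⁻¹ • b)).restrictScalars ℝ) w := fun w => by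
      have := ((hasDerivAt_pow (m + 1) w).hasFDerivAt.smul_const ((m + 1 : ℂ)⁻¹ • b))
      refine (this.restrictScalars ℝ).congr_fderiv ?_
      ext ξ
      simp [mul_comm]
    refine norm_le_of_fderiv_le (g := fun z => u z - z ^ (m + 1) • (m + 1 : ℂ)⁻¹ • b) hε.le
      (fun w hw => (hball w hw).2.sub (hpow w).differentiableAt) (fun w hw ξ => ?_)
      (by simp [hu0]) hz
    rw [fderiv_fun_sub (hball w hw).2 (hpow w).differentiableAt, (hpow w).fderiv]
    have := (hball w hw).1 ξ
    rw [← hcoef] at this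
    simpa using this

end LeadingTerm

section ExistsLeadingTerm

variable {E : Type*} [NormedAddCommGroup E] [NormedSpace ℂ E]

theorem eventually_dbar_fst_snd_le {u : ℂ → E} {J : E → E →L[ℝ] E} (hJ : ContDiffAt ℝ 1 J 0)
    (hJ0 : ∀ w, J 0 w = I • w) (hu : ContDiffAt ℝ 2 u 0) (hu0 : u 0 = 0)
    (hCR : ∀ᶠ z in 𝓝 (0 : ℂ), fderiv ℝ u z I = J (u z) (fderiv ℝ u z 1)) :
    ∃ K : ℝ, 0 ≤ K ∧ ∀ᶠ z in 𝓝 (0 : ℂ),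
      ‖dbar u z‖ ≤ K * ‖fderiv ℝ u z 1‖ ∧
      DifferentiableAt ℝ (fun z => fderiv ℝ u z 1) z ∧
      ‖dbar (fun z => fderiv ℝ u z 1) z‖ ≤ K * max ‖u z‖ ‖fderiv ℝ u z 1‖ := by
  have hu1 : ContDiffAt ℝ 1 u 0 := hu.of_le (by norm_num)
  have hDu : ContDiffAt ℝ 1 (fderiv ℝ u) 0 := hu.fderiv_right (by norm_num)
  have hp : ContDiffAt ℝ 1 (fun z => fderiv ℝ u z 1) 0 := hDu.clm_apply contDiffAt_const
  have hJ' : ContDiffAt ℝ 1 J (u 0) := by rwa [hu0]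
  obtain ⟨L, t, ht, hL⟩ := hJ.exists_lipschitzOnWith
  have h0t : (0 : E) ∈ t := mem_of_mem_nhds ht
  have hut : ∀ᶠ z in 𝓝 (0 : ℂ), u z ∈ t := by
    have : Tendsto u (𝓝 0) (𝓝 0) := by simpa [ContinuousAt, hu0] using hu.continuousAt
    exact this ht
  have hbJ : ∀ᶠ z in 𝓝 (0 : ℂ), ‖J (u z) - J 0‖ < 1 := by
    have h1 : ContinuousAt (fun z => ‖J (u z) - J 0‖) 0 :=
      ((ContinuousAt.comp (f := u) hJ'.continuousAt hu.continuousAt).sub continuousAt_const).norm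
    exact h1.eventually (gt_mem_nhds (by simp [hu0]))
  have hbp : ∀ᶠ z in 𝓝 (0 : ℂ), ‖fderiv ℝ u z 1‖ < ‖fderiv ℝ u 0 1‖ + 1 :=
    hp.continuousAt.norm.eventually (gt_mem_nhds (by simp))
  have hbps : ∀ᶠ z in 𝓝 (0 : ℂ), ‖fderiv ℝ (fun z => fderiv ℝ u z 1) z 1‖ <
      ‖fderiv ℝ (fun z => fderiv ℝ u z 1) 0 1‖ + 1 :=
    ((hp.continuousAt_fderiv one_ne_zero).clm_apply continuousAt_const).norm.eventually
      (gt_mem_nhds (by simp))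
  have hbDJ : ∀ᶠ z in 𝓝 (0 : ℂ), ‖fderiv ℝ J (u z)‖ < ‖fderiv ℝ J 0‖ + 1 := by
    have h1 : ContinuousAt (fun z => ‖fderiv ℝ J (u z)‖) 0 :=
      (ContinuousAt.comp (f := u) (hJ'.continuousAt_fderiv one_ne_zero) hu.continuousAt).norm
    exact h1.eventually (gt_mem_nhds (by simp [hu0]))
  have hJd : ∀ᶠ z in 𝓝 (0 : ℂ), DifferentiableAt ℝ J (u z) := by
    have := hJ'.eventually (by simp)
    filter_upwards [hu.continuousAt.eventually this] with z hz using hz.differentiableAt one_ne_zero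
  set P := ‖fderiv ℝ u 0 1‖ + 1
  set P' := ‖fderiv ℝ (fun z => fderiv ℝ u z 1) 0 1‖ + 1
  set D := ‖fderiv ℝ J 0‖ + 1
  have hP : 0 ≤ P := by positivity
  have hP' : 0 ≤ P' := by positivity
  have hD : 0 ≤ D := by positivity
  refine ⟨1 + L * P' + D * P, by positivity, ?_⟩
  filter_upwards [hCR, hCR.eventually_nhds, hut, hbJ, hbp, hbps, hbDJ, hJd,
    hu.eventually (by simp), hp.eventually (by simp), hDu.eventually (by simp)]
    with z hz hzz hzt hzJ hzp hzps hzDJ hzJd hzu hzpc hzD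
  set p := fun z => fderiv ℝ u z 1 with hpdef
  have hpd : DifferentiableAt ℝ p z := hzpc.differentiableAt one_ne_zero
  have hud : DifferentiableAt ℝ u z := hzu.differentiableAt two_ne_zero
  have hI : ∀ x : E, x + I • J (u z) x = I • ((J (u z) - J 0) x) := fun x => by
    rw [sub_apply, hJ0, smul_sub, smul_smul, I_mul_I]
    simp [add_comm]
  have hK1 : 1 ≤ 1 + L * P' + D * P := by
    have : 0 ≤ L * P' := by positivity
    have : 0 ≤ D * P := by positivity
    linarith
  refine ⟨?_, hpd, ?_⟩
  · have e : dbar u z = I • ((J (u z) - J 0) (p z)) := by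
      rw [dbar, hz, ← hI]
    rw [e, norm_smul, norm_I, one_mul]
    refine (ContinuousLinearMap.le_opNorm _ _).trans ?_
    gcongr
    linarith
  · have hsymm : fderiv ℝ p z I = fderiv ℝ (fun w => fderiv ℝ u w I) z 1 := by
      have hs : IsSymmSndFDerivAt ℝ u z := hzu.isSymmSndFDerivAt (by simp)
      have hdd : DifferentiableAt ℝ (fderiv ℝ u) z := hzD.differentiableAt one_ne_zero
      rw [hpdef, fderiv_clm_apply hdd (differentiableAt_const _),
        fderiv_clm_apply hdd (differentiableAt_const _)]
      simpa using hs I 1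
    have hq : fderiv ℝ (fun w => fderiv ℝ u w I) z 1 =
        J (u z) (fderiv ℝ p z 1) + fderiv ℝ J (u z) (p z) (p z) := by
      have heq : (fun w => fderiv ℝ u w I) =ᶠ[𝓝 z] fun w => J (u w) (p w) := hzz
      have hJu : HasFDerivAt (fun w => J (u w)) ((fderiv ℝ J (u z)).comp (fderiv ℝ u z)) z :=
        hzJd.hasFDerivAt.comp z hud.hasFDerivAt
      rw [heq.fderiv_eq, fderiv_clm_apply hJu.differentiableAt hpd, hJu.fderiv]
      simp [hpdef]
    have e : dbar p z = I • ((J (u z) - J 0) (fderiv ℝ p z 1)) +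
        I • fderiv ℝ J (u z) (p z) (p z) := by
      rw [dbar, hsymm, hq, smul_add, ← add_assoc, hI]
    rw [e]
    have hJL : ‖J (u z) - J 0‖ ≤ L * ‖u z‖ := by
      have := hL.dist_le_mul _ hzt _ h0t
      rwa [dist_eq_norm, dist_zero_right] at this
    set M := max ‖u z‖ ‖p z‖
    have hM : 0 ≤ M := (norm_nonneg _).trans (le_max_left _ _)
    calc _ ≤ ‖J (u z) - J 0‖ * ‖fderiv ℝ p z 1‖ + ‖fderiv ℝ J (u z)‖ * ‖p z‖ * ‖p z‖ := by
          refine (norm_add_le _ _).trans ?_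
          rw [norm_smul, norm_smul, norm_I, one_mul, one_mul]
          gcongr
          · exact ContinuousLinearMap.le_opNorm _ _
          · exact ContinuousLinearMap.le_opNorm₂ _ _ _
      _ ≤ (L * M) * P' + D * P * M := by
          gcongr
          · exact hJL.trans (by gcongr; exact le_max_left _ _)
          · exact le_max_right _ _
      _ ≤ _ := by nlinarith

/-- A nonconstant `J`-holomorphic curve has a well defined leading term. -/
theorem exists_hasLeadingTerm [FiniteDimensional ℂ E] {u : ℂ → E} {J : E → E →L[ℝ] E}
    (hJ : ContDiffAt ℝ 1 J 0)
    (hJ0 : ∀ w, J 0 w = I • w) (hu : ContDiffAt ℝ 2 u 0) (hu0 : u 0 = 0)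
    (hCR : ∀ᶠ z in 𝓝 (0 : ℂ), fderiv ℝ u z I = J (u z) (fderiv ℝ u z 1))
    (hne : ∃ᶠ z in 𝓝[≠] (0 : ℂ), u z ≠ 0) :
    ∃ (m : ℕ) (b : E), b ≠ 0 ∧ HasLeadingTerm u (m + 1) b := by
  have hu1 : ContDiffAt ℝ 1 u 0 := hu.of_le (by norm_num)
  obtain ⟨K, hK, hev⟩ := eventually_dbar_fst_snd_le hJ hJ0 hu hu0 hCR
  set p := fun z => fderiv ℝ u z 1 with hp
  have hpc : ContinuousAt p 0 :=
    (hu1.continuousAt_fderiv one_ne_zero).clm_apply continuousAt_const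
  set η : ℂ → E × E := fun z => (u z, p z) with hη
  have hηc : ContinuousAt η 0 := hu1.continuousAt.prodMk hpc
  have hbd : ∀ᶠ z in 𝓝 (0 : ℂ), ‖η z‖ < ‖η 0‖ + 1 :=
    hηc.norm.eventually (gt_mem_nhds (by simp))
  have hall : ∀ᶠ z in 𝓝 (0 : ℂ), DifferentiableAt ℝ η z ∧ ‖η z‖ ≤ ‖η 0‖ + 1 ∧
      ‖dbar η z‖ ≤ K * ‖η z‖ := by
    filter_upwards [hbd, hev, hu1.eventually (by simp)] with z h1 ⟨h2, h3, h4⟩ h5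
    have hud : DifferentiableAt ℝ u z := h5.differentiableAt one_ne_zero
    refine ⟨hud.prodMk h3, h1.le, ?_⟩
    have e : dbar η z = (dbar u z, dbar p z) := by
      rw [dbar, hη, (hud.hasFDerivAt.prodMk h3.hasFDerivAt).fderiv]
      rfl
    rw [e, Prod.norm_def, Prod.norm_def]
    refine max_le (h2.trans ?_) h4
    gcongr
    exact le_max_right _ _
  obtain ⟨r, hr, hball⟩ := Metric.eventually_nhds_iff_ball.1 hall
  rcases eventually_eq_zero_or_exists_leading_term hr hK
    (fun z _ hz => (hball z (by simpa using hz)).1)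
    (fun z _ hz => (hball z (by simpa using hz)).2.1)
    (fun z _ hz => (hball z (by simpa using hz)).2.2) with h0 | ⟨m, ⟨a, b⟩, hc, ht⟩
  · exact (hne (h0.mono fun z hz h => h (Prod.mk_eq_zero.1 hz).1)).elim
  · have hta : Tendsto (fun z => (z ^ m)⁻¹ • u z) (𝓝[≠] 0) (𝓝 a) :=
      (continuous_fst.tendsto (a, b)).comp ht
    have htb : Tendsto (fun z => (z ^ m)⁻¹ • p z) (𝓝[≠] 0) (𝓝 b) :=
      (continuous_snd.tendsto (a, b)).comp ht
    have hlead := hasLeadingTerm_of_tendsto hJ.continuousAt hJ0 hu1 hu0 hCR htb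
    have hm : ((m : ℂ) + 1) ≠ 0 := by exact_mod_cast m.succ_ne_zero
    refine ⟨m, _, smul_ne_zero (inv_ne_zero hm) fun hb => ?_, hlead⟩
    subst hb
    have ha : a = 0 := by
      refine tendsto_nhds_unique hta ?_
      have hsq : Tendsto (fun z : ℂ => ‖z‖) (𝓝[≠] 0) (𝓝 0) := by
        have := (continuous_norm.tendsto (0 : ℂ)).mono_left (nhdsWithin_le_nhds (s := {0}ᶜ))
        simpa using this
      refine squeeze_zero_norm' ?_ hsq
      have := (hlead 1 one_pos).filter_mono (nhdsWithin_le_nhds (s := {0}ᶜ))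
      filter_upwards [this, self_mem_nhdsWithin] with z hz hz0
      have hz0 : 0 < ‖z‖ := norm_pos_iff.2 hz0
      have h1 := hz.2
      rw [smul_zero, smul_zero, sub_zero, one_mul, pow_succ] at h1
      rw [norm_smul, norm_inv, norm_pow, inv_mul_le_iff₀ (by positivity)]
      exact h1
    exact hc (by rw [ha]; rfl)

end ExistsLeadingTerm

section Contraction

theorem exists_norm_pow_sub_pow_le (m : ℕ) {ε : ℝ} (hε : 0 < ε) :
    ∃ ρ : ℝ, 0 < ρ ∧ ρ ≤ 1 / 2 ∧
      ∀ z w : ℂ, ‖w - z‖ ≤ ρ * ‖z‖ → ‖w ^ m - z ^ m‖ ≤ ε * ‖z‖ ^ m := by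
  have hc : ContinuousAt (fun x : ℂ => x ^ m) 1 := by fun_prop
  obtain ⟨δ, hδ, h⟩ := Metric.continuousAt_iff.1 hc ε hε
  refine ⟨min (1 / 2) (δ / 2), by positivity, min_le_left _ _, fun z w hw => ?_⟩
  by_cases hz : z = 0
  · have : w = 0 := by simpa [hz] using hw
    rw [hz, this]; simp; positivity
  have hz' : 0 < ‖z‖ := norm_pos_iff.2 hz
  have h1 : ‖w / z - 1‖ < δ := by
    rw [div_sub_one hz, norm_div, div_lt_iff₀ hz']
    refine hw.trans_lt ?_
    gcongr
    exact (min_le_right _ _).trans_lt (by linarith)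
  have h2 := h (by rwa [dist_eq_norm])
  rw [dist_eq_norm, one_pow, div_pow, div_sub_one (pow_ne_zero _ hz), norm_div, norm_pow,
    div_lt_iff₀ (by positivity)] at h2
  exact h2.le

theorem exists_eq_zero_of_near_id {f : ℂ → ℂ} {z : ℂ} {R : ℝ} (hR : 0 ≤ R)
    (hf : ∀ w ∈ closedBall z R, ∀ w' ∈ closedBall z R,
      ‖f w - f w' - (w - w')‖ ≤ 1 / 2 * ‖w - w'‖)
    (hz : ‖f z‖ ≤ R / 4) :
    (∃ w ∈ closedBall z (R / 2), f w = 0) ∧ InjOn f (closedBall z R) := by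
  have ha : ApproximatesLinearOn f (ContinuousLinearMap.id ℝ ℂ) (closedBall z R) (1 / 2) :=
    fun w hw w' hw' => by simpa using hf w hw w' hw'
  let g : (ContinuousLinearMap.id ℝ ℂ).NonlinearRightInverse :=
    ⟨id, 1, fun y => by simp, fun y => rfl⟩
  have hs := ha.surjOn_closedBall_of_nonlinearRightInverse g (ε := R / 2) (b := z) (by positivity)
    (closedBall_subset_closedBall (by linarith))
  constructor
  · have h0 : (0 : ℂ) ∈ closedBall (f z) (((g.nnnorm : ℝ)⁻¹ - (1 / 2 : NNReal)) * (R / 2)) := by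
      rw [mem_closedBall, dist_zero_left]
      refine hz.trans (le_of_eq ?_)
      simp only [g]
      push_cast
      ring
    obtain ⟨w, hw, h⟩ := hs h0
    exact ⟨w, hw, h⟩
  · intro w hw w' hw' h
    have := hf w hw w' hw'
    rw [h, sub_self, zero_sub, norm_neg] at this
    have h0 : ‖w - w'‖ = 0 := le_antisymm (by linarith) (norm_nonneg _)
    exact sub_eq_zero.1 (norm_eq_zero.1 h0)

end Contraction

section HoloProj

variable {E : Type*} [NormedAddCommGroup E] [NormedSpace ℂ E]

/-- The projection `(1 - i J) / 2`. -/
noncomputable def holoProj (J : E →L[ℝ] E) : E →L[ℝ] E :=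
  (2⁻¹ : ℝ) • (ContinuousLinearMap.id ℝ E - I • J)

theorem holoProj_apply (J : E →L[ℝ] E) (x : E) : holoProj J x = (2⁻¹ : ℝ) • (x - I • J x) := rfl

theorem holoProj_apply_apply {J : E →L[ℝ] E} (hJ : ∀ x, J (J x) = -x) (x : E) :
    holoProj J (J x) = I • holoProj J x := by
  rw [holoProj_apply, holoProj_apply, hJ, smul_comm I (2⁻¹ : ℝ) (x - I • J x), smul_sub I,
    smul_smul I I, I_mul_I]
  simp [add_comm]

theorem holoProj_sub_id {J J₀ : E →L[ℝ] E} (hJ : ∀ x, J₀ x = I • x) :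
    ‖holoProj J - ContinuousLinearMap.id ℝ E‖ ≤ ‖J - J₀‖ := by
  have : holoProj J - ContinuousLinearMap.id ℝ E = (-(2⁻¹ : ℝ)) • I • (J - J₀) := by
    ext x
    simp only [sub_apply, ContinuousLinearMap.id_apply, smul_apply, holoProj_apply, hJ,
      smul_sub, smul_smul I I, I_mul_I]
    module
  rw [this, norm_smul, norm_smul]
  simp only [norm_neg, norm_inv, Real.norm_ofNat, norm_I, one_mul]
  linarith [norm_nonneg (J - J₀)]

theorem contDiffAt_holoProj {J : E → E →L[ℝ] E} {U : ℂ → E} {z : ℂ}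
    (h : ContDiffAt ℝ 1 (fun z => J (U z)) z) : ContDiffAt ℝ 1 (fun z => holoProj (J (U z))) z :=
  (contDiffAt_const.sub (h.const_smul I)).const_smul (2⁻¹ : ℝ)

theorem norm_dbar_le_of_projection {Q JU JV : E →L[ℝ] E} {dU dV : ℂ →L[ℝ] E} {dψ : ℂ →L[ℝ] ℂ}
    {dQ : ℂ →L[ℝ] E →L[ℝ] E} {h : E} {l : E →L[ℂ] ℂ} {a : ℂ} {C₁ C₂ C₃ C₄ : ℝ}
    (hQJ : ∀ x, Q (JU x) = I • Q x) (hJU : ∀ x, JU (JU x) = -x)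
    (hdU : dU I = JU (dU 1)) (hdV : ∀ ξ, dV (I * ξ) = JV (dV ξ))
    (hl : ∀ ξ, l (Q (dV (dψ ξ) - dU ξ) + dQ ξ h) = 0)
    (hA : ∀ ξ, ‖l (Q (dV ξ)) - a * ξ‖ ≤ 1 / 2 * ‖a‖ * ‖ξ‖)
    (hC₁ : 0 ≤ C₁) (hC₂ : 0 ≤ C₂) (hC₃ : 0 ≤ C₃) (hC₄ : 0 ≤ C₄)
    (h1 : ∀ ξ, ‖dV ξ‖ ≤ C₁ * ‖a‖ * ‖ξ‖) (h2 : ‖dQ‖ ≤ C₂) (h3 : ‖JU - JV‖ ≤ C₃ * ‖h‖)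
    (h4 : ‖dU‖ ≤ C₄) (hQ : ‖Q‖ ≤ 2) (hh : ‖h‖ ≤ 1) :
    ‖a‖ * ‖dψ 1 + I * dψ I‖ ≤
      2 * ‖l‖ * (2 * C₃ * (2 * C₁ * ‖l‖ * (2 * C₄ + C₂)) + 2 * C₂) * ‖h‖ ∧
    ‖(Q (dV (dψ 1) - dU 1) + dQ 1 h) + I • (Q (dV (dψ I) - dU I) + dQ I h)‖ ≤
      (4 * C₁ * ‖l‖ + 1) * (2 * C₃ * (2 * C₁ * ‖l‖ * (2 * C₄ + C₂)) + 2 * C₂) * ‖h‖ := by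
  have hlow : ∀ ξ, ‖a‖ * ‖ξ‖ ≤ 2 * ‖l (Q (dV ξ))‖ := fun ξ => by
    have := norm_sub_norm_le (a * ξ) (l (Q (dV ξ)))
    rw [norm_sub_rev, norm_mul] at this
    linarith [hA ξ]
  have hdQ : ∀ ξ : ℂ, ‖ξ‖ = 1 → ‖dQ ξ h‖ ≤ C₂ * ‖h‖ := fun ξ hξ => by
    have := dQ.le_opNorm₂ ξ h
    rw [hξ, mul_one] at this
    exact this.trans (by gcongr)
  have hψI : ‖a‖ * ‖dψ I‖ ≤ 2 * ‖l‖ * (2 * C₄ + C₂) := by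
    have e := hl I
    rw [map_sub, sub_add, map_sub, sub_eq_zero] at e
    refine (hlow _).trans ?_
    rw [e, mul_assoc]
    gcongr
    refine (l.le_opNorm _).trans ?_
    gcongr
    refine (norm_sub_le _ _).trans ?_
    gcongr
    · refine (Q.le_opNorm _).trans ?_
      have := dU.le_opNorm I
      rw [norm_I, mul_one] at this
      gcongr
      exact this.trans h4
    · exact (hdQ I norm_I).trans (mul_le_of_le_one_right hC₂ hh)
  set C₅ := 2 * C₁ * ‖l‖ * (2 * C₄ + C₂) with hC₅
  have hC₅0 : 0 ≤ C₅ := by positivity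
  have hdVψ : ‖dV (dψ I)‖ ≤ C₅ := by
    refine (h1 _).trans ?_
    rw [mul_assoc]
    refine (mul_le_mul_of_nonneg_left hψI hC₁).trans (le_of_eq ?_)
    rw [hC₅]; ring
  set q := dψ 1 + I * dψ I
  set R := Q ((JU - JV) (dV (dψ I))) + (dQ 1 h + I • dQ I h) with hR
  have hRn : ‖R‖ ≤ (2 * C₃ * C₅ + 2 * C₂) * ‖h‖ := by
    calc ‖R‖ ≤ ‖Q ((JU - JV) (dV (dψ I)))‖ + (‖dQ 1 h‖ + ‖I • dQ I h‖) :=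
          (norm_add_le _ _).trans (by gcongr; exact norm_add_le _ _)
      _ ≤ 2 * (C₃ * ‖h‖ * C₅) + (C₂ * ‖h‖ + C₂ * ‖h‖) := by
        gcongr
        · refine (Q.le_opNorm _).trans ?_
          gcongr
          exact (ContinuousLinearMap.le_opNorm _ _).trans (by gcongr)
        · exact hdQ 1 norm_one
        · rw [norm_smul, norm_I, one_mul]
          exact hdQ I norm_I
      _ = _ := by ring
  set C₆ := 2 * C₃ * C₅ + 2 * C₂
  have hC₆ : 0 ≤ C₆ := by positivity
  have e : (Q (dV (dψ 1) - dU 1) + dQ 1 h) + I • (Q (dV (dψ I) - dU I) + dQ I h) =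
      Q (dV q) + R := by
    have e1 : JU (dU I) = -dU 1 := by rw [hdU, hJU]
    have e2 : dV q = dV (dψ 1) + JV (dV (dψ I)) := by rw [map_add, hdV]
    rw [smul_add, ← hQJ, hR, e2, map_sub JU, e1]
    simp only [map_sub, map_add, map_neg, sub_apply]
    abel
  have hlR : l (Q (dV q)) = -l R := by
    have : l (Q (dV q) + R) = 0 := by
      rw [← e, map_add, map_smul, hl, hl, smul_zero, add_zero]
    rw [map_add] at this
    exact eq_neg_of_add_eq_zero_left this
  have hq : ‖a‖ * ‖q‖ ≤ 2 * ‖l‖ * C₆ * ‖h‖ := by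
    refine (hlow q).trans ?_
    rw [hlR, norm_neg]
    have := l.le_opNorm R
    have := mul_le_mul_of_nonneg_left hRn (norm_nonneg l)
    linarith
  refine ⟨hq, ?_⟩
  rw [e]
  calc ‖Q (dV q) + R‖ ≤ 2 * (C₁ * ‖a‖ * ‖q‖) + C₆ * ‖h‖ := by
        refine (norm_add_le _ _).trans ?_
        gcongr
        refine (Q.le_opNorm _).trans ?_
        gcongr
        exact h1 q
    _ = 2 * C₁ * (‖a‖ * ‖q‖) + C₆ * ‖h‖ := by ring
    _ ≤ 2 * C₁ * (2 * ‖l‖ * C₆ * ‖h‖) + C₆ * ‖h‖ := by gcongr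
    _ = _ := by ring

end HoloProj

section Implicit

theorem differentiableAt_of_unique_zero {F : ℂ × ℂ → ℂ} {F' : ℂ × ℂ →L[ℝ] ℂ} {ψ : ℂ → ℂ} {z : ℂ}
    (hF : HasStrictFDerivAt F F' (z, ψ z)) (hinj : ∀ ξ : ℂ, F' (0, ξ) = 0 → ξ = 0)
    (h0 : F (z, ψ z) = 0) (hu : ∀ᶠ p in 𝓝 (z, ψ z), F p = 0 → p.2 = ψ p.1) :
    DifferentiableAt ℝ ψ z := by
  have hinv : (F' ∘L .inr ℝ ℂ ℂ).IsInvertible := by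
    have hi : Function.Injective (F' ∘L .inr ℝ ℂ ℂ : ℂ →L[ℝ] ℂ).toLinearMap := by
      rw [← LinearMap.ker_eq_bot, LinearMap.ker_eq_bot']
      intro ξ hξ
      exact hinj ξ (by simpa using hξ)
    exact ⟨(LinearEquiv.ofInjectiveEndo _ hi).toContinuousLinearEquiv, by ext x; all_goals rfl⟩
  have ht := hF.tendsto_implicitFunctionOfProdDomain hinv
  have hd := (hF.hasStrictFDerivAt_implicitFunctionOfProdDomain hinv).differentiableAt
  refine hd.congr_of_eventuallyEq ?_
  have e := hF.eventually_apply_implicitFunctionOfProdDomain hinv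
  have hp : Tendsto (fun x => (x, hF.implicitFunctionOfProdDomain hinv x)) (𝓝 z)
      (𝓝 (z, ψ z)) := by
    rw [nhds_prod_eq]
    exact tendsto_id.prodMk ht
  filter_upwards [hp.eventually hu, e] with x h1 h2
  exact (h1 (h2.trans h0)).symm

end Implicit

section Reparametrization

variable {E : Type*} [NormedAddCommGroup E] [NormedSpace ℂ E]

theorem HasLeadingTerm.exists_fderiv_bounds {V : ℂ → E} {m : ℕ} {b : E}
    (hV : HasLeadingTerm V (m + 1) b) {l : E →L[ℂ] ℂ} (hl : l b = 1) {Q : ℂ → E →L[ℝ] E}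
    (hQ : Tendsto Q (𝓝 0) (𝓝 (ContinuousLinearMap.id ℝ E))) :
    ∃ ρ C : ℝ, 0 < ρ ∧ ρ ≤ 1 / 2 ∧ 0 ≤ C ∧ ∀ᶠ z in 𝓝 (0 : ℂ), ∀ w, ‖w - z‖ ≤ ρ * ‖z‖ → ∀ ξ,
      ‖l (Q z (fderiv ℝ V w ξ)) - ((m + 1 : ℕ) : ℂ) * z ^ m * ξ‖ ≤
        1 / 2 * ‖((m + 1 : ℕ) : ℂ) * z ^ m‖ * ‖ξ‖ ∧
      ‖fderiv ℝ V w ξ‖ ≤ C * ‖((m + 1 : ℕ) : ℂ) * z ^ m‖ * ‖ξ‖ := by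
  obtain ⟨ρ, hρ, hρ2, hpow⟩ := exists_norm_pow_sub_pow_le m (ε := 1 / 6) (by norm_num)
  set L : ℝ := ‖l‖ + 1 with hL
  have hL0 : 0 < L := by positivity
  have hLl : ‖l‖ ≤ L := by linarith
  set ε : ℝ := 1 / (6 * L * 2 ^ m) with hε
  have hε0 : 0 < ε := by positivity
  set C : ℝ := 2 ^ m * (‖b‖ + ε) with hC
  have hC0 : 0 < C := by positivity
  refine ⟨ρ, C, hρ, hρ2, hC0.le, ?_⟩
  obtain ⟨δ, hδ, hd⟩ := Metric.eventually_nhds_iff.1 (hV ε hε0)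
  have hQ' : ∀ᶠ z in 𝓝 (0 : ℂ), ‖Q z - ContinuousLinearMap.id ℝ E‖ < 1 / (6 * L * C) := by
    have := (Metric.tendsto_nhds.1 hQ) (1 / (6 * L * C)) (by positivity)
    simpa only [dist_eq_norm] using this
  have hδ' : ∀ᶠ z in 𝓝 (0 : ℂ), ‖z‖ < δ / 2 := by
    filter_upwards [Metric.ball_mem_nhds (0 : ℂ) (half_pos hδ)] with z hz
    simpa using hz
  filter_upwards [hQ', hδ'] with z hQz hz w hw ξ
  have hzn := norm_nonneg z
  have hw2 : ‖w‖ ≤ 2 * ‖z‖ := by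
    have h1 := norm_le_norm_add_norm_sub' w z
    have h2 : ρ * ‖z‖ ≤ 1 / 2 * ‖z‖ := by gcongr
    linarith
  obtain ⟨hdw, -⟩ := hd (y := w) (by rw [dist_zero_right]; linarith)
  specialize hdw ξ
  rw [Nat.add_sub_cancel] at hdw
  set a : ℂ := ((m + 1 : ℕ) : ℂ) * z ^ m with ha
  have han : ‖a‖ = (m + 1) * ‖z‖ ^ m := by
    rw [ha, norm_mul, norm_pow, Complex.norm_natCast]; push_cast; rfl
  have hwm : ‖w‖ ^ m ≤ 2 ^ m * ‖z‖ ^ m := by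
    rw [← mul_pow]; gcongr
  have hza : ‖z‖ ^ m ≤ ‖a‖ := by
    rw [han]; nlinarith [pow_nonneg hzn m, (Nat.cast_nonneg m : (0 : ℝ) ≤ m)]
  set c : ℂ := ((m + 1 : ℕ) : ℂ) * w ^ m with hc
  have hcn : ‖c‖ ≤ 2 ^ m * ‖a‖ := by
    rw [hc, norm_mul, norm_pow, Complex.norm_natCast, han]
    push_cast
    calc ((m : ℝ) + 1) * ‖w‖ ^ m ≤ (m + 1) * (2 ^ m * ‖z‖ ^ m) := by gcongr
      _ = _ := by ring
  have hca : ‖c - a‖ ≤ 1 / 6 * ‖a‖ := by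
    rw [hc, ha, ← mul_sub, norm_mul, norm_mul, norm_pow]
    have := hpow z w hw
    calc _ ≤ ‖((m + 1 : ℕ) : ℂ)‖ * (1 / 6 * ‖z‖ ^ m) := by gcongr
      _ = _ := by ring
  have hrem : ‖fderiv ℝ V w ξ - (c * ξ) • b‖ ≤ ε * 2 ^ m * ‖a‖ * ‖ξ‖ := by
    refine hdw.trans ?_
    calc ε * ‖w‖ ^ m * ‖ξ‖ ≤ ε * (2 ^ m * ‖a‖) * ‖ξ‖ := by
          gcongr
          exact hwm.trans (by gcongr)
      _ = _ := by ring
  have hbd : ‖fderiv ℝ V w ξ‖ ≤ C * ‖a‖ * ‖ξ‖ := by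
    have h1 := norm_le_norm_add_norm_sub' (fderiv ℝ V w ξ) ((c * ξ) • b)
    have h2 : ‖(c * ξ) • b‖ ≤ 2 ^ m * ‖a‖ * ‖ξ‖ * ‖b‖ := by
      rw [norm_smul, norm_mul]; gcongr
    calc _ ≤ 2 ^ m * ‖a‖ * ‖ξ‖ * ‖b‖ + ε * 2 ^ m * ‖a‖ * ‖ξ‖ := by linarith
      _ = _ := by rw [hC]; ring
  refine ⟨?_, hbd⟩
  have e : l (Q z (fderiv ℝ V w ξ)) - a * ξ =
      l ((Q z - ContinuousLinearMap.id ℝ E) (fderiv ℝ V w ξ)) +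
        l (fderiv ℝ V w ξ - (c * ξ) • b) + (c - a) * ξ := by
    simp only [sub_apply, ContinuousLinearMap.id_apply, map_sub, map_smul, hl, smul_eq_mul]
    ring
  rw [e]
  have b1 : ‖l ((Q z - ContinuousLinearMap.id ℝ E) (fderiv ℝ V w ξ))‖ ≤ 1 / 6 * ‖a‖ * ‖ξ‖ := by
    calc _ ≤ ‖l‖ * (‖Q z - ContinuousLinearMap.id ℝ E‖ * ‖fderiv ℝ V w ξ‖) :=
          (l.le_opNorm _).trans (by gcongr; exact ContinuousLinearMap.le_opNorm _ _)
      _ ≤ L * (1 / (6 * L * C) * (C * ‖a‖ * ‖ξ‖)) := by gcongr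
      _ = _ := by field_simp
  have b2 : ‖l (fderiv ℝ V w ξ - (c * ξ) • b)‖ ≤ 1 / 6 * ‖a‖ * ‖ξ‖ := by
    calc _ ≤ L * (ε * 2 ^ m * ‖a‖ * ‖ξ‖) := (l.le_opNorm _).trans (by gcongr)
      _ = _ := by rw [hε]; field_simp
  have b3 : ‖(c - a) * ξ‖ ≤ 1 / 6 * ‖a‖ * ‖ξ‖ := by
    rw [norm_mul]; gcongr
  refine (norm_add₃_le).trans ?_
  linarith

theorem exists_reparametrization {U V : ℂ → E} {m : ℕ} {b : E}
    (hU : HasLeadingTerm U (m + 1) b) (hV : HasLeadingTerm V (m + 1) b)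
    (hVd : ∀ᶠ z in 𝓝 (0 : ℂ), DifferentiableAt ℝ V z)
    {l : E →L[ℂ] ℂ} {Q : ℂ → E →L[ℝ] E} (hQ : ∀ᶠ z in 𝓝 0, ‖Q z‖ ≤ 2) {ρ : ℝ}
    (hρ : 0 < ρ) (hρ2 : ρ ≤ 1 / 2)
    (hd : ∀ᶠ z in 𝓝 (0 : ℂ), ∀ w, ‖w - z‖ ≤ ρ * ‖z‖ → ∀ ξ,
      ‖l (Q z (fderiv ℝ V w ξ)) - ((m + 1 : ℕ) : ℂ) * z ^ m * ξ‖ ≤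
        1 / 2 * ‖((m + 1 : ℕ) : ℂ) * z ^ m‖ * ‖ξ‖) :
    ∃ ψ : ℂ → ℂ, ∀ᶠ z in 𝓝[≠] 0, ‖ψ z - z‖ ≤ ρ / 2 * ‖z‖ ∧ l (Q z (V (ψ z) - U z)) = 0 ∧
      ∀ w, ‖w - z‖ ≤ ρ * ‖z‖ → l (Q z (V w - U z)) = 0 → w = ψ z := by
  have key : ∀ᶠ z in 𝓝[≠] (0 : ℂ), ∃ x, ‖x - z‖ ≤ ρ / 2 * ‖z‖ ∧ l (Q z (V x - U z)) = 0 ∧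
      ∀ w, ‖w - z‖ ≤ ρ * ‖z‖ → l (Q z (V w - U z)) = 0 → w = x := by
    set L : ℝ := ‖l‖ + 1 with hL
    have hL0 : 0 < L := by positivity
    have hLl : ‖l‖ ≤ L := by linarith
    set ε : ℝ := ρ / (16 * L) with hε
    have hε0 : 0 < ε := by positivity
    obtain ⟨δ, hδ, hdiff⟩ := Metric.eventually_nhds_iff.1 hVd
    have hδ' : ∀ᶠ z in 𝓝 (0 : ℂ), ‖z‖ < δ / 2 := by
      filter_upwards [Metric.ball_mem_nhds (0 : ℂ) (half_pos hδ)] with z hz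
      simpa using hz
    filter_upwards [nhdsWithin_le_nhds (hU ε hε0), nhdsWithin_le_nhds (hV ε hε0),
      nhdsWithin_le_nhds hd, nhdsWithin_le_nhds hQ, nhdsWithin_le_nhds hδ', self_mem_nhdsWithin]
      with z hUz hVz hdz hQz hz hz0
    have hz0 : z ≠ 0 := hz0
    have hzn : 0 < ‖z‖ := norm_pos_iff.2 hz0
    set a : ℂ := ((m + 1 : ℕ) : ℂ) * z ^ m with ha
    have ha0 : a ≠ 0 := mul_ne_zero (Nat.cast_ne_zero.2 m.succ_ne_zero) (pow_ne_zero _ hz0)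
    have han : ‖z‖ ^ m ≤ ‖a‖ := by
      rw [ha, norm_mul, norm_pow, Complex.norm_natCast]; push_cast
      nlinarith [pow_nonneg hzn.le m, (Nat.cast_nonneg m : (0 : ℝ) ≤ m)]
    have hap : 0 < ‖a‖ := norm_pos_iff.2 ha0
    set A : E →L[ℝ] ℂ := a⁻¹ • ((l.restrictScalars ℝ) ∘L Q z) with hA
    have hAap : ∀ x, A x = a⁻¹ * l (Q z x) := fun x => rfl
    have hA0 : ∀ x, A x = 0 ↔ l (Q z x) = 0 := fun x => by
      rw [hAap, mul_eq_zero, or_iff_right (inv_ne_zero ha0)]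
    have h1 : ‖A (V z - U z)‖ ≤ ρ * ‖z‖ / 4 := by
      have e1 : ‖V z - U z‖ ≤ 2 * ε * ‖z‖ ^ (m + 1) := by
        calc ‖V z - U z‖ = ‖(V z - z ^ (m + 1) • b) - (U z - z ^ (m + 1) • b)‖ := by congr 1; abel
          _ ≤ _ := (norm_sub_le _ _).trans (by linarith [hUz.2, hVz.2])
      rw [hAap, norm_mul, norm_inv, inv_mul_le_iff₀ hap]
      calc ‖l (Q z (V z - U z))‖ ≤ L * (2 * (2 * ε * ‖z‖ ^ (m + 1))) := by
            refine (l.le_opNorm _).trans ?_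
            gcongr
            exact ((Q z).le_opNorm _).trans (by gcongr)
        _ = ‖z‖ ^ m * (ρ * ‖z‖ / 4) := by rw [hε, pow_succ]; field_simp; ring
        _ ≤ _ := by gcongr
    have hcb : ∀ w, w ∈ closedBall z (ρ * ‖z‖) ↔ ‖w - z‖ ≤ ρ * ‖z‖ := fun w => by
      rw [mem_closedBall, dist_eq_norm]
    have h2 : ∀ w ∈ closedBall z (ρ * ‖z‖), ∀ w' ∈ closedBall z (ρ * ‖z‖),
        ‖A (V w - U z) - A (V w' - U z) - (w - w')‖ ≤ 1 / 2 * ‖w - w'‖ := by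
      intro w hw w' hw'
      have hder : ∀ x ∈ closedBall z (ρ * ‖z‖), HasFDerivWithinAt
          (fun w => A (V w - U z) - w) (A ∘L fderiv ℝ V x - ContinuousLinearMap.id ℝ ℂ)
          (closedBall z (ρ * ‖z‖)) x := by
        intro x hx
        rw [hcb] at hx
        have hxn := norm_le_norm_add_norm_sub' x z
        have h2 : ρ * ‖z‖ ≤ 1 / 2 * ‖z‖ := by gcongr
        have hVx : DifferentiableAt ℝ V x := hdiff (by rw [dist_zero_right]; linarith)
        have := (A.hasFDerivAt.comp x (hVx.hasFDerivAt.sub_const (U z))).sub (hasFDerivAt_id x)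
        exact this.hasFDerivWithinAt
      have hbd : ∀ x ∈ closedBall z (ρ * ‖z‖),
          ‖A ∘L fderiv ℝ V x - ContinuousLinearMap.id ℝ ℂ‖ ≤ 1 / 2 := by
        intro x hx
        rw [hcb] at hx
        refine ContinuousLinearMap.opNorm_le_bound _ (by norm_num) fun ξ => ?_
        have e : (A ∘L fderiv ℝ V x - ContinuousLinearMap.id ℝ ℂ) ξ =
            a⁻¹ * (l (Q z (fderiv ℝ V x ξ)) - a * ξ) := by
          rw [mul_sub, inv_mul_cancel_left₀ ha0]; rfl
        rw [e, norm_mul, norm_inv, inv_mul_le_iff₀ hap]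
        exact (hdz x hx ξ).trans (le_of_eq (by ring))
      have := (convex_closedBall z (ρ * ‖z‖)).norm_image_sub_le_of_norm_hasFDerivWithin_le
        hder hbd hw' hw
      rwa [sub_sub_sub_comm] at this
    obtain ⟨⟨x, hx, hx0⟩, hinj⟩ := exists_eq_zero_of_near_id (by positivity) h2 h1
    refine ⟨x, ?_, (hA0 _).1 hx0, fun w hw h => ?_⟩
    · rw [mem_closedBall, dist_eq_norm] at hx
      linarith
    · refine hinj ((hcb w).2 hw) (closedBall_subset_closedBall ?_ hx) ?_
      · linarith [mul_pos hρ hzn]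
      · exact ((hA0 _).2 h).trans hx0.symm
  classical
  refine ⟨fun z => if h : ∃ x, ‖x - z‖ ≤ ρ / 2 * ‖z‖ ∧ l (Q z (V x - U z)) = 0 ∧
      ∀ w, ‖w - z‖ ≤ ρ * ‖z‖ → l (Q z (V w - U z)) = 0 → w = x then h.choose else 0, ?_⟩
  filter_upwards [key] with z hz
  simp only [dif_pos hz]
  exact hz.choose_spec

end Reparametrization

section MainLemma

variable {E : Type*} [NormedAddCommGroup E] [NormedSpace ℂ E]

theorem apply_I_mul_of_apply_I {A : ℂ →L[ℝ] E} {J : E →L[ℝ] E} (hJ : ∀ x, J (J x) = -x)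
    (h : A I = J (A 1)) (ξ : ℂ) : A (I * ξ) = J (A ξ) := by
  rw [fderiv_apply_eq_re_im A (I * ξ), fderiv_apply_eq_re_im A ξ, h]
  simp [hJ]
  abel

theorem eventually_differentiableAt_of_reparametrization [FiniteDimensional ℂ E]
    {J : E → E →L[ℝ] E} {U V : ℂ → E} {m : ℕ} {b : E} (hb : b ≠ 0)
    (hJ : ContDiffAt ℝ 1 J 0) (hJsq : ∀ x w, J x (J x w) = -w) (hJ0 : ∀ w, J 0 w = I • w)
    (hU : ContDiffAt ℝ 1 U 0) (hV : ContDiffAt ℝ 1 V 0) (hU0 : U 0 = 0) (hV0 : V 0 = 0)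
    (hUCR : ∀ᶠ z in 𝓝 0, fderiv ℝ U z I = J (U z) (fderiv ℝ U z 1))
    (hVCR : ∀ᶠ z in 𝓝 0, fderiv ℝ V z I = J (V z) (fderiv ℝ V z 1))
    (hUb : HasLeadingTerm U (m + 1) b) (hVb : HasLeadingTerm V (m + 1) b)
    (hfreq : ∀ ρ > 0, ∃ᶠ z in 𝓝[≠] (0 : ℂ), ∃ w, ‖w - z‖ ≤ ρ * ‖z‖ ∧ U z = V w) :
    ∃ ψ : ℂ → ℂ, ∀ᶠ z in 𝓝[≠] 0,
      DifferentiableAt ℂ ψ z ∧ U z = V (ψ z) ∧ ‖ψ z‖ ≤ 2 * ‖z‖ := by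
  obtain ⟨l, hl⟩ := SeparatingDual.exists_eq_one (R := ℂ) hb
  set Q : ℂ → E →L[ℝ] E := fun z => holoProj (J (U z)) with hQdef
  have hQc : ContDiffAt ℝ 1 Q 0 :=
    contDiffAt_holoProj (ContDiffAt.comp 0 (by rwa [hU0]) hU)
  have hid : Q 0 = ContinuousLinearMap.id ℝ E := by
    have := holoProj_sub_id (J := J 0) hJ0
    rw [sub_self, norm_zero] at this
    rw [hQdef]
    simp only [hU0]
    exact sub_eq_zero.1 (norm_eq_zero.1 (le_antisymm this (norm_nonneg _)))
  have hQt : Tendsto Q (𝓝 0) (𝓝 (ContinuousLinearMap.id ℝ E)) := by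
    rw [← hid]; exact hQc.continuousAt
  have hQ1 : ∀ᶠ z in 𝓝 (0 : ℂ), ‖Q z - ContinuousLinearMap.id ℝ E‖ < 1 / 2 := by
    have := (Metric.tendsto_nhds.1 hQt) (1 / 2) (by norm_num)
    simpa only [dist_eq_norm] using this
  have hQ2 : ∀ᶠ z in 𝓝 (0 : ℂ), ‖Q z‖ ≤ 2 := by
    filter_upwards [hQ1] with z hz
    have h1 := norm_le_norm_add_norm_sub' (Q z) (ContinuousLinearMap.id ℝ E)
    have h2 := ContinuousLinearMap.norm_id_le (𝕜 := ℝ) (E := E)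
    linarith
  obtain ⟨ρ, C₁, hρ, hρ2, hC₁, hder⟩ := hVb.exists_fderiv_bounds hl hQt
  obtain ⟨ψ, hψ⟩ := exists_reparametrization hUb hVb
    ((hV.eventually (by simp)).mono fun z hz => hz.differentiableAt one_ne_zero) hQ2 hρ hρ2
    (hder.mono fun z hz w hw ξ => (hz w hw ξ).1)
  have hψ2 : ∀ᶠ z in 𝓝[≠] (0 : ℂ), ‖ψ z‖ ≤ 2 * ‖z‖ := by
    filter_upwards [hψ] with z hz
    have h1 := norm_le_norm_add_norm_sub' (ψ z) z
    have h2 : ρ / 2 * ‖z‖ ≤ 1 / 2 * ‖z‖ := by gcongr; linarith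
    linarith [hz.1, norm_nonneg z]
  have hψ0 : Tendsto ψ (𝓝[≠] 0) (𝓝 0) := by
    refine squeeze_zero_norm' hψ2 ?_
    have : Tendsto (fun z : ℂ => 2 * ‖z‖) (𝓝 0) (𝓝 (2 * ‖(0 : ℂ)‖)) :=
      (continuous_const.mul continuous_norm).tendsto 0
    simpa using this.mono_left nhdsWithin_le_nhds
  obtain ⟨K, t, ht, hK⟩ := hJ.exists_lipschitzOnWith
  have hUt : ∀ᶠ z in 𝓝 (0 : ℂ), U z ∈ t := hU.continuousAt (by rwa [hU0])
  have hVt : ∀ᶠ z in 𝓝 (0 : ℂ), V z ∈ t := hV.continuousAt (by rwa [hV0])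
  have hUs : ∀ᶠ z in 𝓝 (0 : ℂ), ‖U z‖ < 1 / 2 :=
    (hU.continuousAt.norm.tendsto).eventually_lt_const (by rw [hU0]; norm_num)
  have hVs : ∀ᶠ z in 𝓝 (0 : ℂ), ‖V z‖ < 1 / 2 :=
    (hV.continuousAt.norm.tendsto).eventually_lt_const (by rw [hV0]; norm_num)
  set C₂ : ℝ := ‖fderiv ℝ Q 0‖ + 1 with hC₂
  set C₄ : ℝ := ‖fderiv ℝ U 0‖ + 1 with hC₄
  have hQb : ∀ᶠ z in 𝓝 (0 : ℂ), ‖fderiv ℝ Q z‖ < C₂ :=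
    ((hQc.fderiv_right (m := 0) (by simp)).continuousAt.norm.tendsto).eventually_lt_const
      (lt_add_one _)
  have hUb' : ∀ᶠ z in 𝓝 (0 : ℂ), ‖fderiv ℝ U z‖ < C₄ :=
    ((hU.fderiv_right (m := 0) (by simp)).continuousAt.norm.tendsto).eventually_lt_const
      (lt_add_one _)
  set h : ℂ → E := fun z => V (ψ z) - U z with hh
  set η : ℂ → E := fun z => Q z (h z) with hη
  have hηh : ∀ᶠ z in 𝓝[≠] (0 : ℂ), ‖h z‖ ≤ 2 * ‖η z‖ := by
    filter_upwards [nhdsWithin_le_nhds hQ1] with z hz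
    have h1 := norm_le_norm_add_norm_sub (η z) (h z)
    have h2 := (Q z - ContinuousLinearMap.id ℝ E).le_opNorm (h z)
    have h3 : (Q z - ContinuousLinearMap.id ℝ E) (h z) = η z - h z := rfl
    rw [h3] at h2
    nlinarith [norm_nonneg (h z)]
  have hh1 : ∀ᶠ z in 𝓝[≠] (0 : ℂ), ‖h z‖ ≤ 1 := by
    filter_upwards [hψ0.eventually hVs, nhdsWithin_le_nhds hUs] with z h1 h2
    exact (norm_sub_le _ _).trans (by linarith)
  have hψ' := eventually_nhdsNE_eventually_nhds_iff.2 hψ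
  have hψd : ∀ᶠ z in 𝓝[≠] (0 : ℂ), DifferentiableAt ℝ ψ z := by
    filter_upwards [hψ, hψ', nhdsWithin_le_nhds hder, nhdsWithin_le_nhds (hU.eventually (by simp)),
      hψ0.eventually (hV.eventually (by simp)), nhdsWithin_le_nhds (hQc.eventually (by simp)),
      self_mem_nhdsWithin] with z hz hz' hdz hUz hVz hQz hz0
    have hz0 : z ≠ 0 := hz0
    have hzn : 0 < ‖z‖ := norm_pos_iff.2 hz0
    have hF : HasStrictFDerivAt (fun p : ℂ × ℂ => V p.2 - U p.1)
        (fderiv ℝ V (ψ z) ∘L .snd ℝ ℂ ℂ - fderiv ℝ U z ∘L .fst ℝ ℂ ℂ) (z, ψ z) :=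
      (HasStrictFDerivAt.comp (z, ψ z) (hVz.hasStrictFDerivAt one_ne_zero)
        hasStrictFDerivAt_snd).sub
      (HasStrictFDerivAt.comp (z, ψ z) (hUz.hasStrictFDerivAt one_ne_zero) hasStrictFDerivAt_fst)
    have hQs : HasStrictFDerivAt (fun p : ℂ × ℂ => Q p.1) (fderiv ℝ Q z ∘L .fst ℝ ℂ ℂ) (z, ψ z) :=
      HasStrictFDerivAt.comp (z, ψ z) (hQz.hasStrictFDerivAt one_ne_zero) hasStrictFDerivAt_fst
    have hlF := ((l.restrictScalars ℝ).hasStrictFDerivAt).comp (z, ψ z) (hQs.clm_apply hF)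
    refine differentiableAt_of_unique_zero hlF (fun ξ hξ => ?_) hz.2.1 ?_
    · have h1 : l (Q z (fderiv ℝ V (ψ z) ξ)) = 0 := by simpa using hξ
      have h2 := (hdz (ψ z) (hz.1.trans (by gcongr; linarith)) ξ).1
      have ha : 0 < ‖((m + 1 : ℕ) : ℂ) * z ^ m‖ :=
        norm_pos_iff.2 (mul_ne_zero (Nat.cast_ne_zero.2 m.succ_ne_zero) (pow_ne_zero _ hz0))
      rw [h1, zero_sub, norm_neg, norm_mul, mul_assoc] at h2
      have h3 : ‖ξ‖ = 0 := by
        by_contra hne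
        have : 0 < ‖ξ‖ := lt_of_le_of_ne (norm_nonneg _) (Ne.symm hne)
        linarith [mul_pos ha this]
      exact norm_eq_zero.1 h3
    · have hc1 : ∀ᶠ p in 𝓝 (z, ψ z), ‖p.2 - p.1‖ - ρ * ‖p.1‖ < 0 := by
        refine Tendsto.eventually_lt_const (v := ‖ψ z - z‖ - ρ * ‖z‖) ?_ ?_
        · linarith [hz.1, mul_pos hρ hzn]
        · exact (Continuous.tendsto (by fun_prop) (z, ψ z) :
            Tendsto (fun p : ℂ × ℂ => ‖p.2 - p.1‖ - ρ * ‖p.1‖) _ _)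
      have hc2 : ∀ᶠ p in 𝓝 (z, ψ z), ∀ w, ‖w - p.1‖ ≤ ρ * ‖p.1‖ →
          l (Q p.1 (V w - U p.1)) = 0 → w = ψ p.1 := by
        have : Tendsto (fun p : ℂ × ℂ => p.1) (𝓝 (z, ψ z)) (𝓝 z) := continuous_fst.tendsto _
        exact this.eventually (hz'.mono fun _ h => h.2.2)
      filter_upwards [hc1, hc2] with p h1 h2 h3
      exact h2 p.2 (by linarith) h3
  set C₅ : ℝ := 2 * K * (2 * C₁ * ‖l‖ * (2 * C₄ + C₂)) + 2 * C₂ with hC₅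
  have hC₂0 : 0 ≤ C₂ := by positivity
  have hC₄0 : 0 ≤ C₄ := by positivity
  have hC₅0 : 0 ≤ C₅ := by positivity
  have main : ∀ᶠ z in 𝓝[≠] (0 : ℂ), DifferentiableAt ℝ η z ∧
      ‖((m + 1 : ℕ) : ℂ) * z ^ m‖ * ‖fderiv ℝ ψ z 1 + I * fderiv ℝ ψ z I‖ ≤
        2 * ‖l‖ * C₅ * ‖h z‖ ∧
      ‖dbar η z‖ ≤ (4 * C₁ * ‖l‖ + 1) * C₅ * ‖h z‖ := by
    filter_upwards [hψ, hψ', nhdsWithin_le_nhds hder, nhdsWithin_le_nhds (hU.eventually (by simp)),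
      hψ0.eventually (hV.eventually (by simp)), nhdsWithin_le_nhds (hQc.eventually (by simp)),
      hψd, nhdsWithin_le_nhds hUCR, hψ0.eventually hVCR, hh1, nhdsWithin_le_nhds hQ2,
      nhdsWithin_le_nhds hQb, nhdsWithin_le_nhds hUb', nhdsWithin_le_nhds hUt, hψ0.eventually hVt]
      with z hz hz' hdz hUz hVz hQz hψz hUI hVI hhz hQz2 hQbz hUbz hUtz hVtz
    have hhd : HasFDerivAt h (fderiv ℝ V (ψ z) ∘L fderiv ℝ ψ z - fderiv ℝ U z) z :=
      (HasFDerivAt.comp z (hVz.differentiableAt one_ne_zero).hasFDerivAt hψz.hasFDerivAt).sub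
        (hUz.differentiableAt one_ne_zero).hasFDerivAt
    have hηd : HasFDerivAt η (Q z ∘L (fderiv ℝ V (ψ z) ∘L fderiv ℝ ψ z - fderiv ℝ U z) +
        (fderiv ℝ Q z).flip (h z)) z :=
      (hQz.differentiableAt one_ne_zero).hasFDerivAt.clm_apply hhd
    have hηap : ∀ ξ, fderiv ℝ η z ξ = Q z (fderiv ℝ V (ψ z) (fderiv ℝ ψ z ξ) - fderiv ℝ U z ξ) +
        fderiv ℝ Q z ξ (h z) := fun ξ => by rw [hηd.fderiv]; rfl
    have hl0 : ∀ ξ, l (Q z (fderiv ℝ V (ψ z) (fderiv ℝ ψ z ξ) - fderiv ℝ U z ξ) +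
        fderiv ℝ Q z ξ (h z)) = 0 := fun ξ => by
      have h1 : HasFDerivAt (fun z => l (η z)) ((l.restrictScalars ℝ) ∘L fderiv ℝ η z) z :=
        (l.restrictScalars ℝ).hasFDerivAt.comp z hηd.differentiableAt.hasFDerivAt
      have h2 : HasFDerivAt (fun z => l (η z)) (0 : ℂ →L[ℝ] ℂ) z :=
        (hasFDerivAt_const (0 : ℂ) z).congr_of_eventuallyEq (hz'.mono fun y hy => hy.2.1)
      rw [← hηap]
      exact DFunLike.congr_fun (h1.unique h2) ξ
    have hwz : ‖ψ z - z‖ ≤ ρ * ‖z‖ := hz.1.trans (by gcongr; linarith)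
    have hlip : ‖J (U z) - J (V (ψ z))‖ ≤ K * ‖h z‖ := by
      have := hK.dist_le_mul _ hVtz _ hUtz
      rw [dist_eq_norm, dist_eq_norm] at this
      rwa [norm_sub_rev]
    obtain ⟨e1, e2⟩ := norm_dbar_le_of_projection (Q := Q z) (JU := J (U z)) (JV := J (V (ψ z)))
      (dU := fderiv ℝ U z) (dV := fderiv ℝ V (ψ z)) (dψ := fderiv ℝ ψ z) (dQ := fderiv ℝ Q z)
      (h := h z) (l := l) (C₃ := (K : ℝ))
      (fun x => holoProj_apply_apply (hJsq _) x) (hJsq _) hUI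
      (apply_I_mul_of_apply_I (hJsq _) hVI) hl0 (fun ξ => (hdz _ hwz ξ).1) hC₁ hC₂0 K.2 hC₄0
      (fun ξ => (hdz _ hwz ξ).2) hQbz.le hlip hUbz.le hQz2 hhz
    refine ⟨hηd.differentiableAt, e1, ?_⟩
    rw [dbar, hηap, hηap]
    exact e2
  have hη0 : ∀ᶠ z in 𝓝[≠] (0 : ℂ), η z = 0 := by
    have hall : ∀ᶠ z in 𝓝[≠] (0 : ℂ), DifferentiableAt ℝ η z ∧ ‖η z‖ ≤ 2 ∧
        ‖dbar η z‖ ≤ (4 * C₁ * ‖l‖ + 1) * C₅ * 2 * ‖η z‖ := by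
      filter_upwards [main, hηh, hh1, nhdsWithin_le_nhds hQ2] with z h1 h2 h3 h4
      refine ⟨h1.1, ?_, h1.2.2.trans ?_⟩
      · exact ((Q z).le_opNorm _).trans (by nlinarith [norm_nonneg (h z)])
      · rw [mul_assoc _ (2 : ℝ)]
        gcongr
    rw [eventually_nhdsWithin_iff, Metric.eventually_nhds_iff] at hall
    obtain ⟨r, hr, hall⟩ := hall
    have hall' : ∀ z : ℂ, z ≠ 0 → ‖z‖ < r → _ := fun z hz hzr =>
      hall (by rwa [dist_zero_right]) hz
    rcases eventually_eq_zero_or_exists_leading_term hr (by positivity)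
      (fun z hz hzr => (hall' z hz hzr).1) (fun z hz hzr => (hall' z hz hzr).2.1)
      (fun z hz hzr => (hall' z hz hzr).2.2) with h0 | ⟨k, c, hc, hk⟩
    · exact h0
    · exfalso
      have hne : ∀ᶠ z in 𝓝[≠] (0 : ℂ), (z ^ k)⁻¹ • η z ≠ 0 := hk.eventually_ne hc
      obtain ⟨z, ⟨w, hw, huv⟩, h1, h2⟩ := ((hfreq ρ hρ).and_eventually (hne.and hψ)).exists
      have hwψ : w = ψ z := h2.2.2 w hw (by rw [huv, sub_self, map_zero, map_zero])
      apply h1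
      simp only [hη, hh, ← hwψ, huv, sub_self, map_zero, smul_zero]
  refine ⟨ψ, ?_⟩
  filter_upwards [hη0, hηh, main, hψ2, hψd, self_mem_nhdsWithin] with z h1 h2 h3 h4 h5 hz0
  have hz0 : z ≠ 0 := hz0
  have hhz : h z = 0 := by
    rw [h1, norm_zero, mul_zero] at h2
    exact norm_eq_zero.1 (le_antisymm h2 (norm_nonneg _))
  refine ⟨?_, (sub_eq_zero.1 hhz).symm, h4⟩
  rw [differentiableAt_complex_iff_differentiableAt_real]
  refine ⟨h5, ?_⟩
  have h6 := h3.2.1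
  rw [hhz, norm_zero, mul_zero] at h6
  have ha : 0 < ‖((m + 1 : ℕ) : ℂ) * z ^ m‖ :=
    norm_pos_iff.2 (mul_ne_zero (Nat.cast_ne_zero.2 m.succ_ne_zero) (pow_ne_zero _ hz0))
  have h7 : fderiv ℝ ψ z 1 + I * fderiv ℝ ψ z I = 0 :=
    norm_eq_zero.1 (le_antisymm (nonpos_of_mul_nonpos_right h6 ha) (norm_nonneg _))
  rw [smul_eq_mul, eq_neg_of_add_eq_zero_left h7, mul_neg, ← mul_assoc, I_mul_I]
  ring

end MainLemma

section ChangeOfParameter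

variable {E : Type*} [NormedAddCommGroup E] [NormedSpace ℂ E]

theorem HasLeadingTerm.comp_mul_pow {u : ℂ → E} {k l : ℕ} {b : E}
    (hu : HasLeadingTerm u (k + 1) b) (hd : ∀ᶠ z in 𝓝 (0 : ℂ), DifferentiableAt ℝ u z) (c : ℂ) :
    HasLeadingTerm (fun z => u (c * z ^ (l + 1))) ((k + 1) * (l + 1)) (c ^ (k + 1) • b) := by
  intro ε hε
  set M : ℝ := ((l + 1 : ℕ) : ℝ) * ‖c‖ ^ (k + 1) + 1 with hM
  have hM0 : 0 < M := by positivity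
  have ht : Tendsto (fun z : ℂ => c * z ^ (l + 1)) (𝓝 0) (𝓝 0) := by
    have : Continuous fun z : ℂ => c * z ^ (l + 1) := by fun_prop
    simpa using this.tendsto 0
  have hε' : 0 < ε / M := by positivity
  have hMl : ((l + 1 : ℕ) : ℝ) * ‖c‖ ^ (k + 1) ≤ M := by linarith
  have hMk : ‖c‖ ^ (k + 1) ≤ M := by
    refine le_trans ?_ hMl
    have : (1 : ℝ) ≤ ((l + 1 : ℕ) : ℝ) := by norm_num
    exact le_mul_of_one_le_left (by positivity) this
  filter_upwards [ht.eventually (hu _ hε'), ht.eventually hd] with z hz hdz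
  constructor
  · intro ξ
    have h1 : HasDerivAt (fun z : ℂ => c * z ^ (l + 1)) (c * (((l + 1 : ℕ) : ℂ) * z ^ l)) z := by
      simpa using (hasDerivAt_pow (l + 1) z).const_mul c
    have h2 := hdz.hasFDerivAt.comp z (h1.hasFDerivAt.restrictScalars ℝ)
    have e1 : fderiv ℝ (fun z => u (c * z ^ (l + 1))) z ξ =
        fderiv ℝ u (c * z ^ (l + 1)) (ξ * (c * (((l + 1 : ℕ) : ℂ) * z ^ l))) := by
      have h3 : HasFDerivAt (fun z => u (c * z ^ (l + 1))) _ z := h2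
      rw [h3.fderiv]
      simp
    have e3 : (k + 1) * (l + 1) - 1 = (l + 1) * k + l := by
      have : (k + 1) * (l + 1) = (l + 1) * k + l + 1 := by ring
      omega
    have e2 : (((k + 1) * (l + 1) : ℕ) : ℂ) * z ^ ((k + 1) * (l + 1) - 1) * ξ * c ^ (k + 1) =
        ((k + 1 : ℕ) : ℂ) * (c * z ^ (l + 1)) ^ (k + 1 - 1) *
          (ξ * (c * (((l + 1 : ℕ) : ℂ) * z ^ l))) := by
      rw [e3, Nat.add_sub_cancel, pow_add, pow_mul]
      push_cast
      ring
    rw [e1, smul_smul, e2]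
    refine (hz.1 _).trans ?_
    rw [Nat.add_sub_cancel, e3]
    simp only [norm_mul, norm_pow, Complex.norm_natCast]
    calc ε / M * (‖c‖ * ‖z‖ ^ (l + 1)) ^ k * (‖ξ‖ * (‖c‖ * (((l + 1 : ℕ) : ℝ) * ‖z‖ ^ l)))
        = ε / M * (((l + 1 : ℕ) : ℝ) * ‖c‖ ^ (k + 1)) * ‖z‖ ^ ((l + 1) * k + l) * ‖ξ‖ := by
          rw [pow_add ‖z‖ ((l + 1) * k), pow_mul ‖z‖]; ring
      _ ≤ ε / M * M * ‖z‖ ^ ((l + 1) * k + l) * ‖ξ‖ := by gcongr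
      _ = _ := by field_simp
  · have e : z ^ ((k + 1) * (l + 1)) • c ^ (k + 1) • b = (c * z ^ (l + 1)) ^ (k + 1) • b := by
      rw [smul_smul, mul_pow, ← pow_mul, mul_comm (l + 1), mul_comm]
    rw [e]
    refine hz.2.trans ?_
    simp only [norm_mul, norm_pow]
    calc ε / M * (‖c‖ * ‖z‖ ^ (l + 1)) ^ (k + 1)
        = ε / M * ‖c‖ ^ (k + 1) * ‖z‖ ^ ((k + 1) * (l + 1)) := by
          rw [mul_pow, ← pow_mul, mul_comm (l + 1)]; ring
      _ ≤ ε / M * M * ‖z‖ ^ ((k + 1) * (l + 1)) := by gcongr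
      _ = _ := by field_simp

theorem exists_frequently_close_of_leadingTerm {U V : ℂ → E} {N : ℕ} {b b' : E} (hN : N ≠ 0)
    (hb : b ≠ 0) (hb' : b' ≠ 0) (hU : HasLeadingTerm U N b) (hV : HasLeadingTerm V N b')
    (hUV : ∀ δ > 0, ∃ z w : ℂ, z ≠ 0 ∧ ‖z‖ < δ ∧ ‖w‖ < δ ∧ U z = V w) :
    ∃ ζ : ℂ, ζ ≠ 0 ∧ ζ ^ N • b' = b ∧
      ∀ ρ > 0, ∃ᶠ z in 𝓝[≠] (0 : ℂ), ∃ w, ‖w - z‖ ≤ ρ * ‖z‖ ∧ U z = V (ζ * w) := by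
  have hj : ∀ j : ℕ, ∃ z w : ℂ, z ≠ 0 ∧ ‖z‖ < 1 / ((j : ℝ) + 1) ∧ ‖w‖ < 1 / ((j : ℝ) + 1) ∧
      U z = V w := fun j => hUV _ (by positivity)
  choose Z W hZ0 hZ hW hZW using hj
  have hZt : Tendsto Z atTop (𝓝 0) :=
    squeeze_zero_norm (fun j => (hZ j).le) tendsto_one_div_add_atTop_nhds_zero_nat
  have hWt : Tendsto W atTop (𝓝 0) :=
    squeeze_zero_norm (fun j => (hW j).le) tendsto_one_div_add_atTop_nhds_zero_nat
  have hZt' : Tendsto Z atTop (𝓝[≠] 0) :=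
    tendsto_nhdsWithin_iff.2 ⟨hZt, Eventually.of_forall hZ0⟩
  have hbp : 0 < ‖b'‖ := norm_pos_iff.2 hb'
  have hmain : ∀ ε > 0, ∀ᶠ j in atTop, ‖b - (W j / Z j) ^ N • b'‖ ≤
      ε * (1 + ‖W j / Z j‖ ^ N) := by
    intro ε hε
    filter_upwards [hZt.eventually (hU ε hε), hWt.eventually (hV ε hε)] with j h1 h2
    have hZj : 0 < ‖Z j‖ := norm_pos_iff.2 (hZ0 j)
    have e : b - (W j / Z j) ^ N • b' = (Z j ^ N)⁻¹ • (Z j ^ N • b - W j ^ N • b') := by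
      rw [smul_sub, inv_smul_smul₀ (pow_ne_zero _ (hZ0 j)), smul_smul, div_pow, div_eq_inv_mul]
    have h3 : ‖Z j ^ N • b - W j ^ N • b'‖ ≤ ε * ‖Z j‖ ^ N + ε * ‖W j‖ ^ N := by
      have : Z j ^ N • b - W j ^ N • b' =
          (V (W j) - W j ^ N • b') - (U (Z j) - Z j ^ N • b) := by rw [hZW]; abel
      rw [this]
      exact (norm_sub_le _ _).trans (by linarith [h1.2, h2.2])
    rw [e, norm_smul, norm_inv, norm_pow, inv_mul_le_iff₀ (by positivity), norm_div, div_pow]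
    refine h3.trans (le_of_eq ?_)
    field_simp
  set M : ℝ := max 1 ((‖b‖ + ‖b'‖ / 2) / (‖b'‖ / 2)) with hM
  have hM1 : 1 ≤ M := le_max_left _ _
  have hbdd : ∀ᶠ j in atTop, ‖W j / Z j‖ ≤ M := by
    filter_upwards [hmain _ (half_pos hbp)] with j hj
    by_contra! hlt
    have h1 : ‖W j / Z j‖ ≤ ‖W j / Z j‖ ^ N := le_self_pow₀ (hM1.trans hlt.le) hN
    have h2 := norm_le_norm_add_norm_sub b ((W j / Z j) ^ N • b')
    rw [norm_smul, norm_pow] at h2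
    have h3 : (‖b‖ + ‖b'‖ / 2) / (‖b'‖ / 2) < ‖W j / Z j‖ ^ N :=
      ((le_max_right _ _).trans_lt hlt).trans_le h1
    rw [div_lt_iff₀ (by positivity)] at h3
    linarith
  obtain ⟨ζ, -, φ, hφ, hζ⟩ := tendsto_subseq_of_frequently_bounded
    (Metric.isBounded_closedBall (x := (0 : ℂ)) (r := M))
    (x := fun j => W j / Z j) (hbdd.mono fun j hj => by simpa using hj).frequently
  have hζb : ζ ^ N • b' = b := by
    have hlim : Tendsto (fun j => ‖b - (W (φ j) / Z (φ j)) ^ N • b'‖) atTop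
        (𝓝 ‖b - ζ ^ N • b'‖) :=
      (tendsto_const_nhds.sub ((hζ.pow N).smul_const b')).norm
    have hle : ∀ ε > 0, ‖b - ζ ^ N • b'‖ ≤ ε * (1 + M ^ N) := fun ε hε => by
      refine le_of_tendsto hlim ?_
      filter_upwards [hφ.tendsto_atTop.eventually (hmain ε hε),
        hφ.tendsto_atTop.eventually hbdd] with j h1 h2
      exact h1.trans (by gcongr)
    have : ‖b - ζ ^ N • b'‖ ≤ 0 := by
      refine le_of_forall_pos_le_add fun ε hε => ?_
      have := hle (ε / (1 + M ^ N)) (by positivity)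
      rwa [div_mul_cancel₀ _ (by positivity), ← zero_add ε] at this
    exact (sub_eq_zero.1 (norm_le_zero_iff.1 this)).symm
  have hζ0 : ζ ≠ 0 := by
    rintro rfl
    rw [zero_pow hN, zero_smul] at hζb
    exact hb hζb.symm
  refine ⟨ζ, hζ0, hζb, fun ρ hρ => ?_⟩
  have hZφ : Tendsto (fun j => Z (φ j)) atTop (𝓝[≠] 0) := hZt'.comp hφ.tendsto_atTop
  refine hZφ.frequently (Eventually.frequently ?_)
  have h1 : Tendsto (fun j => W (φ j) / Z (φ j) / ζ) atTop (𝓝 (ζ / ζ)) := hζ.div_const ζ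
  rw [div_self hζ0] at h1
  filter_upwards [(Metric.tendsto_nhds.1 h1) ρ hρ] with j hj
  refine ⟨W (φ j) / ζ, ?_, by rw [mul_div_cancel₀ _ hζ0]; exact hZW _⟩
  have e : W (φ j) / ζ - Z (φ j) = (W (φ j) / Z (φ j) / ζ - 1) * Z (φ j) := by
    have := hZ0 (φ j)
    field_simp
  rw [e, norm_mul]
  rw [dist_eq_norm] at hj
  gcongr

theorem exists_holomorphic_of_root {F : Type*} [Zero F] {u v : ℂ → F} {g : ℂ → ℂ} {l : ℕ}
    (hl : l ≠ 0) (hvinj : InjOn v (ball 0 1)) (huv : u 0 = v 0)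
    (hg : Tendsto g (𝓝[≠] 0) (𝓝 0))
    (hgu : ∀ᶠ z in 𝓝[≠] (0 : ℂ), DifferentiableAt ℂ g z ∧ u (z ^ l) = v (g z)) :
    ∃ ε > 0, ∃ φ : ℂ → ℂ, MapsTo φ (ball 0 ε) (ball 0 1) ∧ DifferentiableOn ℂ φ (ball 0 ε) ∧
      φ 0 = 0 ∧ ∀ z ∈ ball (0 : ℂ) ε, u z = v (φ z) := by
  have hg1 : ∀ᶠ z in 𝓝[≠] (0 : ℂ), g z ∈ ball (0 : ℂ) 1 := hg (ball_mem_nhds _ one_pos)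
  have hall := hgu.and hg1
  rw [eventually_nhdsWithin_iff, Metric.eventually_nhds_iff] at hall
  obtain ⟨r, hr, hall⟩ := hall
  have hall : ∀ y : ℂ, y ≠ 0 → ‖y‖ < r → (DifferentiableAt ℂ g y ∧ u (y ^ l) = v (g y)) ∧
      g y ∈ ball (0 : ℂ) 1 := fun y hy hyr => hall (by rwa [dist_zero_right]) hy
  have hroot : ∀ z : ℂ, ∃ y : ℂ, y ^ l = z := fun z =>
    IsAlgClosed.exists_pow_nat_eq z (Nat.pos_of_ne_zero hl)
  choose s hs using hroot
  have hy0 : ∀ {y z : ℂ}, y ^ l = z → z ≠ 0 → y ≠ 0 := by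
    rintro y z rfl hz rfl
    exact hz (zero_pow hl)
  have hyr : ∀ {y z : ℂ} {ρ : ℝ}, 0 ≤ ρ → y ^ l = z → ‖z‖ < ρ ^ l → ‖y‖ < ρ := by
    rintro y z ρ hρ rfl hz
    rw [norm_pow] at hz
    exact lt_of_pow_lt_pow_left₀ _ hρ hz
  set φ : ℂ → ℂ := Function.update (fun z => g (s z)) 0 0 with hφ
  have hφ0 : φ 0 = 0 := Function.update_self _ _ _
  have hφne : ∀ {z}, z ≠ 0 → φ z = g (s z) := fun hz => Function.update_of_ne hz _ _
  have hmaps : MapsTo φ (ball 0 (r ^ l)) (ball 0 1) := by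
    intro z hz
    by_cases h : z = 0
    · rw [h, hφ0]; exact mem_ball_self one_pos
    · rw [hφne h]
      exact (hall _ (hy0 (hs z) h) (hyr hr.le (hs z) (by simpa using hz))).2
  have heq : ∀ z ∈ ball (0 : ℂ) (r ^ l), u z = v (φ z) := by
    intro z hz
    by_cases h : z = 0
    · rw [h, hφ0, huv]
    · rw [hφne h, ← (hall _ (hy0 (hs z) h) (hyr hr.le (hs z) (by simpa using hz))).1.2, hs]
  have hφg : ∀ {y z : ℂ}, z ≠ 0 → z ∈ ball (0 : ℂ) (r ^ l) → y ^ l = z → φ z = g y := by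
    intro y z hz hzb hyz
    have h1 := hall y (hy0 hyz hz) (hyr hr.le hyz (by simpa using hzb))
    refine hvinj (hmaps hzb) h1.2 ?_
    rw [← heq z hzb, ← h1.1.2, hyz]
  have hcont : ContinuousAt φ 0 := by
    rw [Metric.continuousAt_iff]
    intro ε hε
    have hgε := (Metric.tendsto_nhds.1 hg) ε hε
    rw [eventually_nhdsWithin_iff, Metric.eventually_nhds_iff] at hgε
    obtain ⟨δ, hδ, hgε⟩ := hgε
    refine ⟨δ ^ l, by positivity, fun z hz => ?_⟩
    rw [dist_zero_right] at hz
    by_cases h : z = 0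
    · rw [h, dist_self]; exact hε
    · rw [hφne h, hφ0]
      exact hgε (by rw [dist_zero_right]; exact hyr hδ.le (hs z) hz) (hy0 (hs z) h)
  refine ⟨r ^ l, by positivity, φ, hmaps, ?_, hφ0, heq⟩
  rw [← Complex.differentiableOn_compl_singleton_and_continuousAt_iff
    (ball_mem_nhds (0 : ℂ) (by positivity : 0 < r ^ l))]
  refine ⟨fun z hz => DifferentiableAt.differentiableWithinAt ?_, hcont⟩
  obtain ⟨hzb, hz0⟩ := hz
  have hz0 : z ≠ 0 := hz0
  set t : ℂ → ℂ := fun x => s z * (x / z) ^ ((l : ℂ)⁻¹) with ht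
  have htz : t z = s z := by simp [ht, div_self hz0]
  have htd : DifferentiableAt ℂ t z := by
    refine DifferentiableAt.const_mul ?_ _
    refine DifferentiableAt.cpow_const (differentiableAt_id.div_const z) ?_
    rw [div_self hz0]
    exact one_mem_slitPlane
  have htp : ∀ x, t x ^ l = x := fun x => by
    rw [ht]
    simp only
    rw [mul_pow, hs, Complex.cpow_nat_inv_pow _ hl, mul_div_cancel₀ _ hz0]
  have hgd : DifferentiableAt ℂ g (t z) := by
    rw [htz]
    exact (hall _ (hy0 (hs z) hz0) (hyr hr.le (hs z) (by simpa using hzb))).1.1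
  refine (hgd.comp z htd).congr_of_eventuallyEq ?_
  filter_upwards [isOpen_ball.mem_nhds hzb, isOpen_ne.mem_nhds hz0] with x hx hx0
  exact hφg hx0 hx (htp x)

theorem local_intersections_of_standard_at_zero [FiniteDimensional ℂ E] {J : E → E →L[ℝ] E}
    {u v : ℂ → E}
    (hJ : ContDiffAt ℝ 1 J 0) (hJsq : ∀ x w, J x (J x w) = -w) (hJ0 : ∀ w, J 0 w = I • w)
    (hu : ContDiffAt ℝ 2 u 0) (hv : ContDiffAt ℝ 2 v 0) (hu0 : u 0 = 0) (hv0 : v 0 = 0)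
    (huCR : ∀ᶠ z in 𝓝 0, fderiv ℝ u z I = J (u z) (fderiv ℝ u z 1))
    (hvCR : ∀ᶠ z in 𝓝 0, fderiv ℝ v z I = J (v z) (fderiv ℝ v z 1))
    (huinj : InjOn u (ball 0 1)) (hvinj : InjOn v (ball 0 1)) :
    ∃ ε > 0, (∃ φ : ℂ → ℂ, MapsTo φ (ball 0 ε) (ball 0 1) ∧ DifferentiableOn ℂ φ (ball 0 ε) ∧
        φ 0 = 0 ∧ ∀ z ∈ ball (0 : ℂ) ε, u z = v (φ z)) ∨
      ∀ z w : ℂ, z ≠ 0 → w ≠ 0 → ‖z‖ < ε → ‖w‖ < ε → u z ≠ v w := by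
  by_cases hdis : ∃ ε > 0, ∀ z w : ℂ, z ≠ 0 → w ≠ 0 → ‖z‖ < ε → ‖w‖ < ε → u z ≠ v w
  · obtain ⟨ε, hε, h⟩ := hdis
    exact ⟨ε, hε, Or.inr h⟩
  push Not at hdis
  have hne : ∀ {f : ℂ → E}, f 0 = 0 → InjOn f (ball 0 1) → ∃ᶠ z in 𝓝[≠] (0 : ℂ), f z ≠ 0 := by
    intro f hf0 hf
    refine Eventually.frequently ?_
    filter_upwards [nhdsWithin_le_nhds (ball_mem_nhds (0 : ℂ) one_pos), self_mem_nhdsWithin]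
      with z hz hz0 h
    exact hz0 (hf hz (mem_ball_self one_pos) (h.trans hf0.symm))
  obtain ⟨k, b, hb, hub⟩ := exists_hasLeadingTerm hJ hJ0 hu hu0 huCR (hne hu0 huinj)
  obtain ⟨l, b', hb', hvb⟩ := exists_hasLeadingTerm hJ hJ0 hv hv0 hvCR (hne hv0 hvinj)
  have hdiff : ∀ {f : ℂ → E}, ContDiffAt ℝ 2 f 0 → ∀ᶠ z in 𝓝 (0 : ℂ), DifferentiableAt ℝ f z :=
    fun hf => (hf.eventually (by simp)).mono fun z hz => hz.differentiableAt two_ne_zero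
  have hpow : ∀ (c : ℂ) (p : ℕ), ContDiffAt ℝ 2 (fun z : ℂ => c * z ^ (p + 1)) 0 :=
    fun c p => by fun_prop
  have hpow0 : ∀ (c : ℂ) (p : ℕ), c * (0 : ℂ) ^ (p + 1) = 0 := fun c p => by simp
  have hcomp : ∀ {f : ℂ → E}, ContDiffAt ℝ 2 f 0 → ∀ (c : ℂ) (p : ℕ),
      ContDiffAt ℝ 2 (fun z : ℂ => f (c * z ^ (p + 1))) 0 := fun hf c p =>
    ContDiffAt.comp (0 : ℂ) (by rwa [hpow0]) (hpow c p)
  have hcompCR : ∀ {f : ℂ → E}, ContDiffAt ℝ 2 f 0 →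
      (∀ᶠ z in 𝓝 0, fderiv ℝ f z I = J (f z) (fderiv ℝ f z 1)) → ∀ (c : ℂ) (p : ℕ),
      ∀ᶠ z in 𝓝 (0 : ℂ), fderiv ℝ (fun z : ℂ => f (c * z ^ (p + 1))) z I =
        J (f (c * z ^ (p + 1))) (fderiv ℝ (fun z : ℂ => f (c * z ^ (p + 1))) z 1) := by
    intro f hf hCR c p
    have ht : Tendsto (fun z : ℂ => c * z ^ (p + 1)) (𝓝 0) (𝓝 0) := by
      have := (hpow c p).continuousAt.tendsto
      rwa [hpow0] at this
    filter_upwards [ht.eventually hCR, ht.eventually (hdiff hf)] with z hz hdz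
    have h1 : DifferentiableAt ℂ (fun z : ℂ => c * z ^ (p + 1)) z := by fun_prop
    have h2 : HasFDerivAt (fun z : ℂ => f (c * z ^ (p + 1))) _ z :=
      hdz.hasFDerivAt.comp z (h1.hasFDerivAt.restrictScalars ℝ)
    rw [h2.fderiv]
    simp only [ContinuousLinearMap.comp_apply, ContinuousLinearMap.coe_restrictScalars']
    rw [← apply_I_mul_of_apply_I (hJsq _) hz, ← smul_eq_mul I, ← map_smul, smul_eq_mul, mul_one]
  have hUb := hub.comp_mul_pow (l := l) (hdiff hu) 1
  have hVb := hvb.comp_mul_pow (l := k) (hdiff hv) 1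
  rw [one_pow, one_smul] at hUb hVb
  rw [mul_comm] at hVb
  obtain ⟨ζ, hζ, hζb, hfreq⟩ := exists_frequently_close_of_leadingTerm (by positivity) hb hb' hUb hVb
    (fun δ hδ => by
      obtain ⟨z, w, hz, -, hzδ, hwδ, huv⟩ := hdis (min (δ ^ (l + 1)) (δ ^ (k + 1))) (by positivity)
      obtain ⟨Z, rfl⟩ := IsAlgClosed.exists_pow_nat_eq z l.succ_pos
      obtain ⟨W, rfl⟩ := IsAlgClosed.exists_pow_nat_eq w k.succ_pos
      rw [norm_pow] at hzδ hwδ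
      refine ⟨Z, W, ?_, lt_of_pow_lt_pow_left₀ _ hδ.le (hzδ.trans_le (min_le_left _ _)),
        lt_of_pow_lt_pow_left₀ _ hδ.le (hwδ.trans_le (min_le_right _ _)), by simpa using huv⟩
      rintro rfl
      simp at hz)
  set V : ℂ → E := fun z => v (ζ ^ (k + 1) * z ^ (k + 1)) with hV
  have hN : (k + 1) * (l + 1) = (k * l + k + l) + 1 := by ring
  have hVb' : HasLeadingTerm V ((k + 1) * (l + 1)) b := by
    have := hvb.comp_mul_pow (l := k) (hdiff hv) (ζ ^ (k + 1))
    rwa [← pow_mul, hζb, mul_comm] at this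
  rw [hN] at hUb hVb'
  obtain ⟨ψ, hψ⟩ := eventually_differentiableAt_of_reparametrization hb hJ hJsq hJ0
    ((hcomp hu 1 l).of_le one_le_two) ((hcomp hv (ζ ^ (k + 1)) k).of_le one_le_two)
    (by rw [hpow0, hu0]) (by rw [hpow0, hv0]) (hcompCR hu huCR 1 l)
    (hcompCR hv hvCR (ζ ^ (k + 1)) k) hUb hVb' (fun ρ hρ => by
      refine (hfreq ρ hρ).mono ?_
      rintro z ⟨w, hw, h⟩
      refine ⟨w, hw, h.trans ?_⟩
      simp only [one_mul, mul_pow])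
  have hψ0 : Tendsto ψ (𝓝[≠] 0) (𝓝 0) := by
    refine squeeze_zero_norm' (hψ.mono fun z hz => hz.2.2) ?_
    have : Tendsto (fun z : ℂ => 2 * ‖z‖) (𝓝 0) (𝓝 (2 * ‖(0 : ℂ)‖)) :=
      (continuous_const.mul continuous_norm).tendsto 0
    simpa using this.mono_left nhdsWithin_le_nhds
  have hg0 : Tendsto (fun z => ζ ^ (k + 1) * ψ z ^ (k + 1)) (𝓝[≠] 0) (𝓝 0) := by
    have := (hψ0.pow (k + 1)).const_mul (ζ ^ (k + 1))
    rwa [hpow0] at this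
  obtain ⟨ε, hε, h⟩ := exists_holomorphic_of_root l.succ_ne_zero hvinj (hu0.trans hv0.symm) hg0
    (by
      filter_upwards [hψ] with z hz
      refine ⟨(hz.1.pow _).const_mul _, ?_⟩
      simpa using hz.2.1)
  exact ⟨ε, hε, Or.inl h⟩

end ChangeOfParameter

section Transfer

theorem exists_equiv_complex {E : Type*} [NormedAddCommGroup E] [NormedSpace ℝ E]
    [FiniteDimensional ℝ E] (J : E →L[ℝ] E) (hJ : ∀ x, J (J x) = -x) :
    ∃ (F : Type) (_ : NormedAddCommGroup F) (_ : NormedSpace ℂ F) (_ : FiniteDimensional ℂ F)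
      (L : E ≃L[ℝ] F), ∀ x, L (J x) = I • L x := by
  let f : ℂ →ₐ[ℝ] Module.End ℝ E := Complex.lift ⟨J.toLinearMap, by ext x; simpa using hJ x⟩
  let : Module ℂ E := Module.compHom E f.toRingHom
  have hsmul : ∀ (c : ℂ) (x : E), c • x = f c x := fun _ _ => rfl
  have hI : ∀ x : E, I • x = J x := fun x => by
    rw [hsmul]
    simp [f]
  have hreal : ∀ (r : ℝ) (x : E), (r : ℂ) • x = r • x := fun r x => by
    rw [hsmul, Complex.coe_algebraMap.symm, AlgHom.commutes]
    rfl
  have : IsScalarTower ℝ ℂ E := ⟨fun r c x => by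
    rw [← hreal, Complex.real_smul, mul_smul]⟩
  have : FiniteDimensional ℂ E := Module.Finite.of_restrictScalars_finite ℝ ℂ E
  let B := (Module.finBasis ℂ E).equivFun
  let L : E ≃ₗ[ℝ] (Fin (Module.finrank ℂ E) → ℂ) :=
    { B with
      map_smul' := fun r x => by
        change B (r • x) = (r : ℂ) • B x
        rw [← hreal, map_smul] }
  exact ⟨_, inferInstance, inferInstance, inferInstance, L.toContinuousLinearEquiv, fun x => by
    change B (J x) = I • B x
    rw [← hI, map_smul]⟩

theorem local_intersections_of_contDiff {E : Type*} [NormedAddCommGroup E] [NormedSpace ℝ E]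
    [FiniteDimensional ℝ E] {J : E → E →L[ℝ] E} {u v : ℂ → E}
    (hJ : ContDiffAt ℝ 1 J 0) (hJsq : ∀ x w, J x (J x w) = -w)
    (hu : ContDiffAt ℝ 2 u 0) (hv : ContDiffAt ℝ 2 v 0) (hu0 : u 0 = 0) (hv0 : v 0 = 0)
    (huCR : ∀ᶠ z in 𝓝 0, fderiv ℝ u z 1 + J (u z) (fderiv ℝ u z I) = 0)
    (hvCR : ∀ᶠ z in 𝓝 0, fderiv ℝ v z 1 + J (v z) (fderiv ℝ v z I) = 0)
    (huinj : InjOn u (ball 0 1)) (hvinj : InjOn v (ball 0 1)) :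
    ∃ ε > 0, (∃ φ : ℂ → ℂ, MapsTo φ (ball 0 ε) (ball 0 1) ∧ DifferentiableOn ℂ φ (ball 0 ε) ∧
        φ 0 = 0 ∧ ∀ z ∈ ball (0 : ℂ) ε, u z = v (φ z)) ∨
      ∀ z w : ℂ, z ≠ 0 → w ≠ 0 → ‖z‖ < ε → ‖w‖ < ε → u z ≠ v w := by
  obtain ⟨F, _, _, _, L, hL⟩ := exists_equiv_complex (J 0) (hJsq 0)
  set J' : F → F →L[ℝ] F := fun x =>
    (L : E →L[ℝ] F) ∘L (J (L.symm x) ∘L (L.symm : F →L[ℝ] E)) with hJ'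
  have hJ'ap : ∀ x w, J' x w = L (J (L.symm x) (L.symm w)) := fun _ _ => rfl
  have hcd : ContDiffAt ℝ 1 J' 0 := by
    have h1 : ContDiffAt ℝ 1 (fun x => J (L.symm x)) 0 :=
      ContDiffAt.comp (0 : F) (by rwa [map_zero]) L.symm.contDiff.contDiffAt
    exact contDiffAt_const.clm_comp (h1.clm_comp contDiffAt_const)
  have hCR : ∀ {f : ℂ → E}, (∀ᶠ z in 𝓝 0, fderiv ℝ f z 1 + J (f z) (fderiv ℝ f z I) = 0) →
      ∀ᶠ z in 𝓝 0, fderiv ℝ (fun z => L (f z)) z I =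
        J' (L (f z)) (fderiv ℝ (fun z => L (f z)) z 1) := by
    intro f hf
    filter_upwards [hf] with z hz
    have e : fderiv ℝ (fun z => L (f z)) z = (L : E →L[ℝ] F) ∘L fderiv ℝ f z := L.comp_fderiv
    rw [e, hJ'ap]
    simp only [ContinuousLinearMap.comp_apply, ContinuousLinearEquiv.coe_coe,
      ContinuousLinearEquiv.symm_apply_apply]
    rw [eq_neg_of_add_eq_zero_left hz, map_neg, hJsq, neg_neg]
  obtain ⟨ε, hε, h⟩ := local_intersections_of_standard_at_zero (J := J') (u := fun z => L (u z))
    (v := fun z => L (v z)) hcd (fun x w => by simp [hJ'ap, hJsq])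
    (fun w => by simp [hJ'ap, hL]) (L.contDiff.contDiffAt.comp 0 hu)
    (L.contDiff.contDiffAt.comp 0 hv) (by simp [hu0]) (by simp [hv0]) (hCR huCR) (hCR hvCR)
    (L.injective.comp_injOn huinj) (L.injective.comp_injOn hvinj)
  refine ⟨ε, hε, h.imp ?_ ?_⟩
  · rintro ⟨φ, h1, h2, h3, h4⟩
    exact ⟨φ, h1, h2, h3, fun z hz => L.injective (h4 z hz)⟩
  · exact fun h z w hz hw hzε hwε e => h z w hz hw hzε hwε (congrArg L e)

end Transfer

end LocalIntersections

/-- **Local intersections of injective pseudoholomorphic curves.**  Let `u, v : B → ℂⁿ`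
be injective smooth `J`-holomorphic curves with `u(0) = v(0) = 0`.  Then for all
sufficiently small `ε > 0`, either `u = v ∘ φ` on `B_ε` for some holomorphic
`φ : B_ε → B` with `φ(0) = 0`, or `u(B_ε \ {0})` and `v(B_ε \ {0})` are disjoint. -/
theorem pseudoholomorphic_local_intersections (n : ℕ)
    (J : EuclideanSpace ℂ (Fin n) →
      (EuclideanSpace ℂ (Fin n) →L[ℝ] EuclideanSpace ℂ (Fin n)))
    (hJsmooth : ContDiff ℝ (⊤ : ℕ∞) J)
    (hJsq : ∀ x w, J x (J x w) = -w)
    (u v : ℂ → EuclideanSpace ℂ (Fin n))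
    (husmooth : ContDiffOn ℝ (⊤ : ℕ∞) u (ball 0 1))
    (hvsmooth : ContDiffOn ℝ (⊤ : ℕ∞) v (ball 0 1))
    (huinj : Set.InjOn u (ball 0 1))
    (hvinj : Set.InjOn v (ball 0 1))
    (huCR : ∀ z ∈ ball (0 : ℂ) 1,
      fderiv ℝ u z 1 + J (u z) (fderiv ℝ u z Complex.I) = 0)
    (hvCR : ∀ z ∈ ball (0 : ℂ) 1,
      fderiv ℝ v z 1 + J (v z) (fderiv ℝ v z Complex.I) = 0)
    (hu0 : u 0 = 0) (hv0 : v 0 = 0) :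
    ∃ ε₀ : ℝ, 0 < ε₀ ∧ ∀ ε : ℝ, 0 < ε → ε ≤ ε₀ →
      ((∃ φ : ℂ → ℂ, Set.MapsTo φ (ball 0 ε) (ball 0 1) ∧
          DifferentiableOn ℂ φ (ball 0 ε) ∧ φ 0 = 0 ∧
          ∀ z ∈ ball (0 : ℂ) ε, u z = v (φ z)) ∨
        (u '' (ball 0 ε \ {0}) ∩ v '' (ball 0 ε \ {0}) = ∅)) := by
  have hball : ball (0 : ℂ) 1 ∈ nhds 0 := ball_mem_nhds _ one_pos
  have h2 : (2 : WithTop ℕ∞) ≤ ((⊤ : ℕ∞) : WithTop ℕ∞) := WithTop.coe_le_coe.2 le_top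
  have : FiniteDimensional ℝ (EuclideanSpace ℂ (Fin n)) :=
    Module.Finite.trans ℂ (EuclideanSpace ℂ (Fin n))
  obtain ⟨ε₀, hε₀, h⟩ := local_intersections_of_contDiff
    (hJsmooth.contDiffAt.of_le (mod_cast le_top)) hJsq
    ((husmooth.contDiffAt hball).of_le h2)
    ((hvsmooth.contDiffAt hball).of_le h2) hu0 hv0
    (Filter.eventually_of_mem hball huCR) (Filter.eventually_of_mem hball hvCR) huinj hvinj
  refine ⟨ε₀, hε₀, fun ε _ hle => h.imp ?_ fun h => ?_⟩
  · rintro ⟨φ, h1, h2, h3, h4⟩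
    have hsub : ball (0 : ℂ) ε ⊆ ball 0 ε₀ := ball_subset_ball hle
    exact ⟨φ, h1.mono_left hsub, h2.mono hsub, h3, fun z hz => h4 z (hsub hz)⟩
  · rw [Set.eq_empty_iff_forall_notMem]
    rintro _ ⟨⟨z, ⟨hz, hz0⟩, rfl⟩, w, ⟨hw, hw0⟩, hzw⟩
    rw [mem_ball_zero_iff] at hz hw
    exact h z w hz0 hw0 (hz.trans_le hle) (hw.trans_le hle) hzw.symm
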